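/- arXiv:1411.3610 — 11 statements merged into one kernel-verified Lean document; each statement's English description precedes it below -/
import Mathlib

section
/- Let n ≥ 4 be an integer and let α = (α₁,α₂,α₃) ∈ ℂ³. The function (x,y,z) ↦ |x−y|^{Re α₃} · |y−z|^{Re α₁} · |z−x|^{Re α₂} is integrable on S×S×S with respect to the product of the surface measures if and only if Re α_j > −(n−1) for j = 1,2,3 and Re(α₁+α₂+α₃) > −2(n−1). -/
open MeasureTheory Metric

/-- The unit sphere `S^{n-1}` in `ℝⁿ`. -/
abbrev unitSphere (n : ℕ) := Metric.sphere (0 : EuclideanSpace ℝ (Fin n)) 1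

/-- The surface measure on the unit sphere induced by the Euclidean structure. -/
noncomputable def sphereMeasure (n : ℕ) : Measure (unitSphere n) :=
  (volume : Measure (EuclideanSpace ℝ (Fin n))).toSphere

open Set Filter Topology ENNReal

/-- A measure is Ahlfors `d`-regular (at scales at most `1`, with the upper bound at all scales)
if the measure of a closed ball of radius `r` is comparable to `r ^ d`. -/
structure IsAhlforsRegular {X : Type*} [MetricSpace X] [MeasurableSpace X] (μ : Measure X)
    (d : ℝ) : Prop where
  pos : 0 < d
  upper : ∃ C, 0 < C ∧ ∀ x r, 0 < r → μ.real (closedBall x r) ≤ C * r ^ d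
  lower : ∃ c, 0 < c ∧ ∀ x r, 0 < r → r ≤ 1 → c * r ^ d ≤ μ.real (closedBall x r)

section Sphere

theorem dist_inv_norm_smul_self {E : Type*} [NormedAddCommGroup E] [NormedSpace ℝ E] {v : E}
    (hv : v ≠ 0) : dist v (‖v‖⁻¹ • v) = |‖v‖ - 1| := by
  have : v - ‖v‖⁻¹ • v = (‖v‖ - 1) • ‖v‖⁻¹ • v := by
    rw [sub_smul, smul_smul, mul_inv_cancel₀ (norm_ne_zero_iff.2 hv)]; simp
  rw [dist_eq_norm, this, norm_smul, norm_smul, norm_inv, norm_norm,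
    inv_mul_cancel₀ (norm_ne_zero_iff.2 hv), mul_one, Real.norm_eq_abs]

variable {E : Type*} [NormedAddCommGroup E] [NormedSpace ℝ E] [MeasurableSpace E] [BorelSpace E]
  [FiniteDimensional ℝ E] (μ : Measure E) [μ.IsAddHaarMeasure]

/-- The measure of the truncated cone of all vectors with norm in `[a, b)` and direction in `s`. -/
theorem measureReal_truncatedCone [Nontrivial E] {s : Set (sphere (0 : E) 1)}
    (hs : MeasurableSet s) {a b : Ioi (0 : ℝ)} (hab : a ≤ b) :
    μ.real ((↑) '' (homeomorphUnitSphereProd E ⁻¹' s ×ˢ Ico a b)) =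
      μ.toSphere.real s * (((b : ℝ) ^ Module.finrank ℝ E - (a : ℝ) ^ Module.finrank ℝ E) /
        Module.finrank ℝ E) := by
  have ha : 0 < (a : ℝ) := a.2
  have hb : 0 < (b : ℝ) := b.2
  have hpos : 0 < Module.finrank ℝ E := Module.finrank_pos
  have hsucc : Module.finrank ℝ E - 1 + 1 = Module.finrank ℝ E := Nat.sub_add_cancel hpos
  have hcast : ((Module.finrank ℝ E - 1 : ℕ) : ℝ) + 1 = Module.finrank ℝ E := by
    exact_mod_cast hsucc
  have hm : MeasurableSet (s ×ˢ Ico a b) :=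
    hs.prod measurableSet_Ico
  have key := (Measure.measurePreserving_homeomorphUnitSphereProd μ).measure_preimage
    hm.nullMeasurableSet
  rw [comap_subtype_coe_apply (measurableSet_singleton _).compl, Measure.prod_prod] at key
  rw [measureReal_def, key, ENNReal.toReal_mul, ← measureReal_def, ← measureReal_def]
  congr 1
  rw [← Iio_sdiff_Iio, measureReal_sdiff (Iio_subset_Iio hab)
    measurableSet_Iio (by simp [Measure.volumeIoiPow_apply_Iio])]
  simp only [measureReal_def, Measure.volumeIoiPow_apply_Iio, hsucc, hcast]
  rw [ENNReal.toReal_ofReal (by positivity),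
    ENNReal.toReal_ofReal (by positivity), sub_div]

theorem toSphere_real_closedBall_le [Nontrivial E] (x : sphere (0 : E) 1) {r : ℝ} (hr : 0 < r) :
    μ.toSphere.real (closedBall x r) ≤
      Module.finrank ℝ E * 2 ^ Module.finrank ℝ E * μ.real (ball 0 1) *
        r ^ (Module.finrank ℝ E - 1) := by
  have hpos : 0 < Module.finrank ℝ E := Module.finrank_pos
  set n := Module.finrank ℝ E with hn
  have hn0 : (0 : ℝ) < n := by exact_mod_cast hpos
  rcases lt_or_ge r 1 with h1 | h1
  · have hsub : ((↑) '' (homeomorphUnitSphereProd E ⁻¹' closedBall x r ×ˢ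
        Ico (⟨1 - r, mem_Ioi.2 (sub_pos.2 h1)⟩ : Ioi (0 : ℝ)) ⟨1, mem_Ioi.2 one_pos⟩)) ⊆
        closedBall (x : E) (2 * r) := by
      rintro _ ⟨⟨v, hv⟩, ⟨hv1, hv2⟩, rfl⟩
      have hv0 : v ≠ 0 := hv
      simp only [mem_closedBall, Subtype.dist_eq, homeomorphUnitSphereProd_apply_fst_coe] at hv1
      simp only [mem_Ico, ← Subtype.coe_le_coe, ← Subtype.coe_lt_coe,
        homeomorphUnitSphereProd_apply_snd_coe] at hv2
      have h2 : dist v (‖v‖⁻¹ • v) = |‖v‖ - 1| := dist_inv_norm_smul_self hv0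
      have h3 : |‖v‖ - 1| ≤ r := by rw [abs_le]; constructor <;> linarith [hv2.1, hv2.2]
      rw [mem_closedBall]
      linarith [dist_triangle v (‖v‖⁻¹ • v) x]
    have h := measureReal_mono (μ := μ) hsub measure_closedBall_lt_top.ne
    rw [measureReal_truncatedCone μ isClosed_closedBall.measurableSet
      (Subtype.mk_le_mk.2 (by linarith)),
      Measure.addHaar_real_closedBall _ _ (by positivity), ← hn, one_pow, mul_pow] at h
    have h4 : r / n ≤ (1 - (1 - r) ^ n) / n := by
      gcongr
      linarith [pow_le_of_le_one (by linarith : 0 ≤ 1 - r) (by linarith) hpos.ne']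
    have h5 := (mul_le_mul_of_nonneg_left h4 measureReal_nonneg).trans h
    have h6 : r ^ n = r ^ (n - 1) * r := by rw [← pow_succ, Nat.sub_add_cancel hpos]
    rw [h6, ← mul_div_assoc, div_le_iff₀ hn0] at h5
    refine le_of_mul_le_mul_right (h5.trans_eq ?_) hr
    ring
  · calc μ.toSphere.real (closedBall x r) ≤ μ.toSphere.real univ := measureReal_mono (subset_univ _)
      _ = n * 1 * μ.real (ball 0 1) * 1 := by rw [Measure.toSphere_real_apply_univ]; simp [hn]
      _ ≤ _ := by gcongr <;> exact one_le_pow₀ (by linarith)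

theorem le_toSphere_real_closedBall [Nontrivial E] (x : sphere (0 : E) 1) {r : ℝ} (hr : 0 < r)
    (hr1 : r ≤ 1 / 2) :
    μ.real (ball 0 1) / (2 * (3 / 2) ^ (Module.finrank ℝ E - 1)) * r ^ (Module.finrank ℝ E - 1) ≤
      μ.toSphere.real (closedBall x (2 * r)) := by
  have hpos : 0 < Module.finrank ℝ E := Module.finrank_pos
  set n := Module.finrank ℝ E with hn
  have hn0 : (0 : ℝ) < n := by exact_mod_cast hpos
  have hr₁ : 1 - r ∈ Ioi 0 := mem_Ioi.2 (by linarith)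
  have hr₂ : 1 + r ∈ Ioi 0 := mem_Ioi.2 (by linarith)
  have hsub : ball (x : E) r ⊆ ((↑) '' (homeomorphUnitSphereProd E ⁻¹' closedBall x (2 * r) ×ˢ
        Ico (⟨1 - r, hr₁⟩ : Ioi (0 : ℝ)) ⟨1 + r, hr₂⟩)) := by
    intro v hv
    have hx : ‖(x : E)‖ = 1 := mem_sphere_zero_iff_norm.1 x.2
    rw [mem_ball] at hv
    have h1 : |‖v‖ - 1| < r := by
      rw [← hx]; exact (abs_norm_sub_norm_le _ _).trans_lt (by rwa [← dist_eq_norm])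
    obtain ⟨h1a, h1b⟩ := abs_lt.1 h1
    have hv0 : v ≠ 0 := norm_pos_iff.1 (by linarith)
    refine ⟨⟨v, hv0⟩, ⟨?_, ?_⟩, rfl⟩
    · simp only [mem_closedBall, Subtype.dist_eq, homeomorphUnitSphereProd_apply_fst_coe]
      have h2 : dist v (‖v‖⁻¹ • v) = |‖v‖ - 1| := dist_inv_norm_smul_self hv0
      rw [dist_comm] at h2
      linarith [dist_triangle (‖v‖⁻¹ • v) v x]
    · simp only [mem_Ico, ← Subtype.coe_le_coe, ← Subtype.coe_lt_coe,
        homeomorphUnitSphereProd_apply_snd_coe]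
      constructor <;> linarith
  have hfin : μ ((↑) '' (homeomorphUnitSphereProd E ⁻¹' closedBall x (2 * r) ×ˢ
        Ico (⟨1 - r, hr₁⟩ : Ioi (0 : ℝ)) ⟨1 + r, hr₂⟩)) ≠ ⊤ := by
    refine ne_top_of_le_ne_top (measure_ball_lt_top (x := (0 : E)) (r := 1 + r)).ne
      (measure_mono ?_)
    rintro _ ⟨v, ⟨-, hv⟩, rfl⟩
    rw [mem_ball_zero_iff]
    simpa only [← Subtype.coe_lt_coe, homeomorphUnitSphereProd_apply_snd_coe] using hv.2
  have h := measureReal_mono (μ := μ) hsub hfin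
  rw [measureReal_truncatedCone μ isClosed_closedBall.measurableSet
      (Subtype.mk_le_mk.2 (by linarith)),
    measureReal_def μ (ball _ _), Measure.addHaar_ball μ _ hr.le, ENNReal.toReal_mul,
    ENNReal.toReal_ofReal (by positivity), ← measureReal_def, ← hn] at h
  have h4 : ((1 + r) ^ n - (1 - r) ^ n) / n ≤ 2 * (3 / 2) ^ (n - 1) * r := by
    rw [div_le_iff₀ hn0]
    calc (1 + r) ^ n - (1 - r) ^ n ≤ |(1 + r) ^ n - (1 - r) ^ n| := le_abs_self _
      _ ≤ |(1 + r) - (1 - r)| * n * max |1 + r| |1 - r| ^ (n - 1) := abs_pow_sub_pow_le ..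
      _ ≤ (2 * r) * n * (3 / 2) ^ (n - 1) := by
        gcongr
        · rw [abs_of_nonneg] <;> linarith
        · rw [max_le_iff, abs_of_nonneg (by linarith), abs_of_nonneg (by linarith)]
          constructor <;> linarith
      _ = _ := by ring
  have h5 := h.trans (mul_le_mul_of_nonneg_left h4 measureReal_nonneg)
  have h6 : r ^ n = r ^ (n - 1) * r := by rw [← pow_succ, Nat.sub_add_cancel hpos]
  rw [h6] at h5
  rw [div_mul_eq_mul_div, div_le_iff₀ (by positivity)]
  refine le_of_mul_le_mul_right (Eq.trans_le ?_ (h5.trans_eq ?_)) hr <;> ring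

theorem isAhlforsRegular_toSphere (h : 2 ≤ Module.finrank ℝ E) :
    IsAhlforsRegular μ.toSphere ((Module.finrank ℝ E : ℝ) - 1) := by
  have : Nontrivial E := Module.nontrivial_of_finrank_pos (R := ℝ) (by omega)
  have hω : 0 < μ.real (ball 0 1) := ENNReal.toReal_pos (measure_ball_pos μ _ one_pos).ne'
    measure_ball_lt_top.ne
  have hcast : (Module.finrank ℝ E : ℝ) - 1 = ((Module.finrank ℝ E - 1 : ℕ) : ℝ) := by
    rw [Nat.cast_sub (by omega), Nat.cast_one]
  have hpos : 0 < (Module.finrank ℝ E : ℝ) := by exact_mod_cast (by omega)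
  rw [hcast]
  refine ⟨by exact_mod_cast (by omega), ⟨Module.finrank ℝ E * 2 ^ Module.finrank ℝ E *
    μ.real (ball 0 1), by positivity, fun x r hr ↦ ?_⟩,
    ⟨μ.real (ball 0 1) / (2 * (3 / 2) ^ (Module.finrank ℝ E - 1)) /
      2 ^ (Module.finrank ℝ E - 1), by positivity, fun x r hr hr1 ↦ ?_⟩⟩
  · rw [Real.rpow_natCast]
    exact toSphere_real_closedBall_le μ x hr
  · have h := le_toSphere_real_closedBall μ x (r := r / 2) (by linarith) (by linarith)
    rw [mul_div_cancel₀ _ two_ne_zero, div_pow r] at h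
    rw [Real.rpow_natCast]
    exact Eq.trans_le (by ring) h

end Sphere

theorem tendsto_const_mul_rpow_nhdsGT_zero (C : ℝ) {d : ℝ} (hd : 0 < d) :
    Tendsto (fun r : ℝ ↦ C * r ^ d) (𝓝[>] 0) (𝓝 0) := by
  have : Tendsto (fun r : ℝ ↦ C * r ^ d) (𝓝 0) (𝓝 (C * 0 ^ d)) :=
    ((Real.continuous_rpow_const hd.le).tendsto 0).const_mul C
  rw [Real.zero_rpow hd.ne', mul_zero] at this
  exact this.mono_left nhdsWithin_le_nhds

theorem rpow_le_mul_rpow_of_comparable {L t u : ℝ} (s : ℝ) (hL : 1 ≤ L) (ht : 0 ≤ t) (hu : 0 ≤ u)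
    (htu : t ≤ L * u) (hut : u ≤ L * t) : u ^ s ≤ L ^ |s| * t ^ s := by
  have hL0 : 0 < L := by linarith
  rcases ht.eq_or_lt with rfl | ht
  · obtain rfl : u = 0 := le_antisymm (by simpa using hut) hu
    exact le_mul_of_one_le_left (Real.rpow_nonneg le_rfl _) (Real.one_le_rpow hL (abs_nonneg s))
  rcases le_total 0 s with hs | hs
  · rw [abs_of_nonneg hs, ← Real.mul_rpow hL0.le ht.le]
    exact Real.rpow_le_rpow hu hut hs
  · have htL : t / L ≤ u := by rwa [div_le_iff₀' hL0]
    calc u ^ s ≤ (t / L) ^ s := Real.rpow_le_rpow_of_nonpos (by positivity) htL hs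
      _ = L ^ |s| * t ^ s := by
        rw [abs_of_nonpos hs, Real.div_rpow ht.le hL0.le, Real.rpow_neg hL0.le]; field_simp

theorem measurePreserving_rotate {X : Type*} [MeasurableSpace X] (μ : Measure X) [SFinite μ] :
    MeasurePreserving (fun p : X × X × X ↦ (p.2.1, p.2.2, p.1)) (μ.prod (μ.prod μ))
      (μ.prod (μ.prod μ)) :=
  (measurePreserving_prodAssoc μ μ μ).comp Measure.measurePreserving_swap

theorem IsAhlforsRegular.nullSingletonClass {X : Type*} [MetricSpace X] [MeasurableSpace X]
    {μ : Measure X} [IsFiniteMeasure μ] {d : ℝ} (h : IsAhlforsRegular μ d) :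
    NullSingletonClass μ := by
  obtain ⟨C, -, hC⟩ := h.upper
  refine ⟨fun x ↦ ?_⟩
  rw [← measureReal_eq_zero_iff]
  refine le_antisymm (ge_of_tendsto (tendsto_const_mul_rpow_nhdsGT_zero C h.pos) ?_)
    measureReal_nonneg
  filter_upwards [self_mem_nhdsWithin] with r hr
  exact (measureReal_mono (singleton_subset_iff.2 (mem_closedBall_self (le_of_lt hr)))).trans
    (hC x r hr)

theorem IsAhlforsRegular.exists_annulus_ge {X : Type*} [MetricSpace X] [MeasurableSpace X]
    {μ : Measure X} [IsFiniteMeasure μ] {d : ℝ} (h : IsAhlforsRegular μ d) :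
    ∃ ε, 0 < ε ∧ ε < 1 ∧ ∃ κ, 0 < κ ∧ ∀ x t, 0 < t → t ≤ 1 →
      ENNReal.ofReal (κ * t ^ d) ≤ μ (closedBall x t \ closedBall x (ε * t)) := by
  obtain ⟨C, hC0, hC⟩ := h.upper
  obtain ⟨c, hc0, hc⟩ := h.lower
  obtain ⟨ε, hε, hε0, hε1⟩ := (((tendsto_const_mul_rpow_nhdsGT_zero C
    h.pos).eventually_lt_const (half_pos hc0)).and (Ioo_mem_nhdsGT one_pos)).exists
  refine ⟨ε, hε0, hε1, c / 2, half_pos hc0, fun x t ht ht1 ↦ ?_⟩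
  rw [← ofReal_measureReal]
  refine ENNReal.ofReal_le_ofReal ?_
  have h1 := le_measureReal_sdiff (μ := μ) (s₁ := closedBall x t) (s₂ := closedBall x (ε * t))
  have h2 := hC x (ε * t) (by positivity)
  rw [Real.mul_rpow hε0.le ht.le, ← mul_assoc] at h2
  have h3 : C * ε ^ d * t ^ d ≤ c / 2 * t ^ d := by gcongr
  linarith [hc x t ht ht1]

section TripleKernel

variable {X : Type*} [MetricSpace X]

theorem closedBall_subset_iUnion_annuli (x : X) (ρ : ℝ) :
    closedBall x ρ ⊆ {x} ∪ ⋃ k : ℕ, closedBall x (ρ / 2 ^ k) \ closedBall x (ρ / 2 ^ (k + 1)) := by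
  intro y hy
  rcases eq_or_ne y x with rfl | hne
  · simp
  right
  have hd : 0 < dist y x := dist_pos.2 hne
  rw [mem_closedBall] at hy
  have hex : ∃ k : ℕ, ρ / 2 ^ k < dist y x := by
    have : Tendsto (fun k : ℕ ↦ ρ * (1 / 2 : ℝ) ^ k) atTop (𝓝 (ρ * 0)) :=
      (_root_.tendsto_pow_atTop_nhds_zero_of_lt_one (by norm_num) (by norm_num)).const_mul ρ
    rw [mul_zero] at this
    obtain ⟨k, hk⟩ := (this.eventually_lt_const hd).exists
    exact ⟨k, by simpa [div_eq_mul_inv] using hk⟩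
  classical
  obtain ⟨k, hk⟩ : ∃ k, Nat.find hex = k + 1 := by
    refine Nat.exists_eq_succ_of_ne_zero fun h0 ↦ ?_
    have := Nat.find_spec hex
    rw [h0, pow_zero, div_one] at this
    linarith
  refine mem_iUnion.2 ⟨k, ?_, ?_⟩
  · exact not_lt.1 (Nat.find_min hex (by omega : k < Nat.find hex))
  · have := Nat.find_spec hex
    rw [hk] at this
    simpa using this

/-- The kernel `|x - y| ^ c * |y - z| ^ a * |z - x| ^ b`. -/
noncomputable def tripleKernel (a b c : ℝ) (p : X × X × X) : ℝ :=
  dist p.1 p.2.1 ^ c * dist p.2.1 p.2.2 ^ a * dist p.2.2 p.1 ^ b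

theorem tripleKernel_nonneg (a b c : ℝ) (p : X × X × X) : 0 ≤ tripleKernel a b c p := by
  unfold tripleKernel; positivity

theorem tripleKernel_rotate (a b c : ℝ) (p : X × X × X) :
    tripleKernel b c a (p.2.1, p.2.2, p.1) = tripleKernel a b c p := by
  simp only [tripleKernel]; ring

variable (X) in
/-- The triples `(x, y, z)` for which the smallest of the three distances is `|z - x|`. -/
def closestOuter : Set (X × X × X) :=
  {p | dist p.2.2 p.1 ≤ dist p.1 p.2.1} ∩ {p | dist p.2.2 p.1 ≤ dist p.2.1 p.2.2}

theorem tripleKernel_le_of_mem_closestOuter (a b c : ℝ) {p : X × X × X} (hp : p ∈ closestOuter X) :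
    tripleKernel a b c p ≤
      2 ^ |a| * dist p.1 p.2.1 ^ c * dist p.1 p.2.1 ^ a * dist p.2.2 p.1 ^ b := by
  obtain ⟨x, y, z⟩ := p
  obtain ⟨h1, h2⟩ := hp
  simp only [tripleKernel, mem_ofPred_eq] at *
  have h3 : dist y z ^ a ≤ 2 ^ |a| * dist x y ^ a := by
    refine rpow_le_mul_rpow_of_comparable a one_le_two dist_nonneg dist_nonneg ?_ ?_
    · linarith [dist_triangle x z y, dist_comm x z, dist_comm y z]
    · linarith [dist_triangle y x z, dist_comm x z, dist_comm x y]
  calc _ ≤ dist x y ^ c * (2 ^ |a| * dist x y ^ a) * dist z x ^ b := by gcongr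
    _ = _ := by ring

variable (X) in
/-- The triples `(x, y, z)` with `ε * r < |y - x| ≤ r` and `ε * R < |z - x| ≤ R`. -/
def twoScaleSet (ε r R : ℝ) : Set (X × X × X) :=
  {p | p.2.1 ∈ closedBall p.1 r \ closedBall p.1 (ε * r) ∧
    p.2.2 ∈ closedBall p.1 R \ closedBall p.1 (ε * R)}

theorem le_tripleKernel_of_mem_twoScaleSet (a b c : ℝ) {ε r R : ℝ} (hε0 : 0 < ε) (hε1 : ε < 1)
    (hr : 0 < r) (hrR : r ≤ ε / 2 * R) {p : X × X × X} (hp : p ∈ twoScaleSet X ε r R) :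
    r ^ c * R ^ a * R ^ b ≤
      (2 / ε) ^ |c| * (2 / ε) ^ |a| * (2 / ε) ^ |b| * tripleKernel a b c p := by
  obtain ⟨x, y, z⟩ := p
  obtain ⟨⟨h1, h2⟩, h3, h4⟩ := hp
  simp only [mem_closedBall, not_le, tripleKernel] at *
  have hR : 0 < R := pos_of_mul_pos_right (hr.trans_le hrR) (by positivity)
  have hrR' : r ≤ R := hrR.trans (mul_le_of_le_one_left hR.le (by linarith))
  have hL : 1 ≤ 2 / ε := by rw [le_div_iff₀ hε0]; linarith
  have comparable {t u : ℝ} (h : ε / 2 * t ≤ u) : t ≤ 2 / ε * u := by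
    rw [div_mul_eq_mul_div, le_div_iff₀ hε0]; linarith
  have comparable' {t u : ℝ} (ht : 0 ≤ t) (h : u ≤ 2 * t) : u ≤ 2 / ε * t :=
    h.trans (by gcongr; rw [le_div_iff₀ hε0]; linarith)
  have hy : r ^ c ≤ (2 / ε) ^ |c| * dist x y ^ c := by
    rw [dist_comm x y]
    refine rpow_le_mul_rpow_of_comparable c hL dist_nonneg hr.le (comparable' hr.le ?_)
      (comparable ?_)
    · linarith
    · linarith [mul_pos hε0 hr]
  have hz : R ^ b ≤ (2 / ε) ^ |b| * dist z x ^ b := by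
    refine rpow_le_mul_rpow_of_comparable b hL dist_nonneg hR.le (comparable' hR.le ?_)
      (comparable ?_)
    · linarith
    · linarith [mul_pos hε0 hR]
  have hyz : R ^ a ≤ (2 / ε) ^ |a| * dist y z ^ a := by
    refine rpow_le_mul_rpow_of_comparable a hL dist_nonneg hR.le (comparable' hR.le ?_)
      (comparable ?_)
    · linarith [dist_triangle y x z, dist_comm x z]
    · linarith [dist_triangle z y x, dist_comm y z]
  calc r ^ c * R ^ a * R ^ b ≤ ((2 / ε) ^ |c| * dist x y ^ c) * ((2 / ε) ^ |a| * dist y z ^ a) *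
        ((2 / ε) ^ |b| * dist z x ^ b) := by gcongr
    _ = _ := by ring

end TripleKernel

section AhlforsRegular

variable {X : Type*} [MetricSpace X] [MeasurableSpace X] [BorelSpace X] {μ : Measure X}
  [IsFiniteMeasure μ] {d : ℝ}

theorem IsAhlforsRegular.exists_setLIntegral_closedBall_le (h : IsAhlforsRegular μ d) {s : ℝ}
    (hs : -d < s) : ∃ K, 0 < K ∧ ∀ x ρ, 0 < ρ →
      ∫⁻ y in closedBall x ρ, ENNReal.ofReal (dist y x ^ s) ∂μ ≤
        ENNReal.ofReal (K * ρ ^ (s + d)) := by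
  have := h.nullSingletonClass
  obtain ⟨C, hC0, hC⟩ := h.upper
  set q : ℝ := (1 / 2) ^ (s + d) with hq
  have hq0 : 0 < q := by positivity
  have hq1 : q < 1 := Real.rpow_lt_one (by norm_num) (by norm_num) (by linarith)
  refine ⟨2 ^ |s| * C * (1 - q)⁻¹, mul_pos (by positivity) (inv_pos.2 (by linarith)),
    fun x ρ hρ ↦ ?_⟩
  have annulus (k : ℕ) : ∫⁻ y in closedBall x (ρ / 2 ^ k) \ closedBall x (ρ / 2 ^ (k + 1)),
      ENNReal.ofReal (dist y x ^ s) ∂μ ≤ ENNReal.ofReal (2 ^ |s| * C * ρ ^ (s + d) * q ^ k) := by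
    set t := ρ / 2 ^ k with ht
    have ht0 : 0 < t := by positivity
    have ht2 : ρ / 2 ^ (k + 1) = t / 2 := by rw [pow_succ, ht]; field_simp
    rw [ht2]
    calc ∫⁻ y in closedBall x t \ closedBall x (t / 2), ENNReal.ofReal (dist y x ^ s) ∂μ
        ≤ ∫⁻ y in closedBall x t \ closedBall x (t / 2), ENNReal.ofReal (2 ^ |s| * t ^ s) ∂μ := by
          refine setLIntegral_mono' (isClosed_closedBall.measurableSet.diff
            isClosed_closedBall.measurableSet) fun y hy ↦ ENNReal.ofReal_le_ofReal ?_
          obtain ⟨hy1, hy2⟩ := hy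
          rw [mem_closedBall] at hy1 hy2
          exact rpow_le_mul_rpow_of_comparable s one_le_two ht0.le dist_nonneg (by linarith)
            (by linarith)
      _ ≤ ENNReal.ofReal (2 ^ |s| * t ^ s) * μ (closedBall x t) := by
          rw [setLIntegral_const]; gcongr; exact sdiff_subset
      _ ≤ ENNReal.ofReal (2 ^ |s| * t ^ s) * ENNReal.ofReal (C * t ^ d) := by
          rw [← ofReal_measureReal]; gcongr; exact hC x t ht0
      _ = _ := by
          rw [← ENNReal.ofReal_mul (by positivity)]
          congr 1
          have : t ^ (s + d) = ρ ^ (s + d) * q ^ k := by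
            rw [hq, ← Real.rpow_natCast, ← Real.rpow_mul (by norm_num), mul_comm (s + d),
              Real.rpow_mul (by norm_num), Real.rpow_natCast, ← Real.mul_rpow hρ.le (by positivity),
              ht, one_div, inv_pow, div_eq_mul_inv]
          rw [mul_assoc (2 ^ |s| * C), ← this, Real.rpow_add ht0]; ring
  have hsum : Summable fun k : ℕ ↦ 2 ^ |s| * C * ρ ^ (s + d) * q ^ k :=
    (summable_geometric_of_lt_one hq0.le hq1).mul_left _
  calc ∫⁻ y in closedBall x ρ, ENNReal.ofReal (dist y x ^ s) ∂μ
      ≤ ∫⁻ y in {x} ∪ ⋃ k : ℕ, closedBall x (ρ / 2 ^ k) \ closedBall x (ρ / 2 ^ (k + 1)),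
          ENNReal.ofReal (dist y x ^ s) ∂μ :=
        lintegral_mono_set (closedBall_subset_iUnion_annuli x ρ)
    _ ≤ 0 + ∑' k : ℕ, ENNReal.ofReal (2 ^ |s| * C * ρ ^ (s + d) * q ^ k) := by
        refine (lintegral_union_le _ _ _).trans (add_le_add ?_ ?_)
        · rw [setLIntegral_measure_zero _ _ (measure_singleton x)]
        · exact (lintegral_iUnion_le _ _).trans (ENNReal.tsum_le_tsum annulus)
    _ = _ := by
        rw [zero_add, ← ENNReal.ofReal_tsum_of_nonneg (fun k ↦ by positivity) hsum, tsum_mul_left,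
          tsum_geometric_of_lt_one hq0.le hq1]
        congr 1; ring

theorem measurable_tripleKernel [SecondCountableTopology X] (a b c : ℝ) :
    Measurable (tripleKernel (X := X) a b c) := by
  unfold tripleKernel; fun_prop

theorem measurableSet_closestOuter [SecondCountableTopology X] :
    MeasurableSet (closestOuter X) :=
  (measurableSet_le (by fun_prop) (by fun_prop)).inter
    (measurableSet_le (by fun_prop) (by fun_prop))

theorem IsAhlforsRegular.setLIntegral_closestOuter_lt_top [BoundedSpace X]
    [SecondCountableTopology X] (h : IsAhlforsRegular μ d) {a b c : ℝ} (hb : -d < b)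
    (habc : -(2 * d) < a + b + c) :
    ∫⁻ p in closestOuter X, ENNReal.ofReal (tripleKernel a b c p) ∂μ.prod (μ.prod μ) < ∞ := by
  have := h.nullSingletonClass
  obtain ⟨K, hK0, hK⟩ := h.exists_setLIntegral_closedBall_le hb
  obtain ⟨K', hK'0, hK'⟩ := h.exists_setLIntegral_closedBall_le
    (s := a + b + c + d) (by linarith)
  have inner (x y : X) (hxy : y ≠ x) : ∫⁻ z, (closestOuter X).indicator
      (fun p ↦ ENNReal.ofReal (tripleKernel a b c p)) (x, y, z) ∂μ ≤
      ENNReal.ofReal (2 ^ |a| * K) * ENNReal.ofReal (dist y x ^ (a + b + c + d)) := by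
    have hd : 0 < dist x y := dist_pos.2 hxy.symm
    calc _ ≤ ∫⁻ z, (closedBall x (dist x y)).indicator (fun z ↦
          ENNReal.ofReal (2 ^ |a| * dist x y ^ c * dist x y ^ a) *
            ENNReal.ofReal (dist z x ^ b)) z ∂μ := by
          refine lintegral_mono fun z ↦ ?_
          by_cases hz : (x, y, z) ∈ closestOuter X
          · rw [indicator_of_mem hz, indicator_of_mem (mem_closedBall.2 hz.1),
              ← ENNReal.ofReal_mul (by positivity)]
            exact ENNReal.ofReal_le_ofReal (tripleKernel_le_of_mem_closestOuter a b c hz)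
          · rw [indicator_of_notMem hz]; exact zero_le
      _ = ENNReal.ofReal (2 ^ |a| * dist x y ^ c * dist x y ^ a) *
          ∫⁻ z in closedBall x (dist x y), ENNReal.ofReal (dist z x ^ b) ∂μ := by
          rw [lintegral_indicator isClosed_closedBall.measurableSet,
            lintegral_const_mul' _ _ ENNReal.ofReal_ne_top]
      _ ≤ ENNReal.ofReal (2 ^ |a| * dist x y ^ c * dist x y ^ a) *
          ENNReal.ofReal (K * dist x y ^ (b + d)) := by gcongr; exact hK x _ hd
      _ = _ := by
          rw [← ENNReal.ofReal_mul (by positivity), ← ENNReal.ofReal_mul (by positivity),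
            dist_comm y x, show a + b + c + d = c + a + (b + d) by ring,
            Real.rpow_add hd (c + a), Real.rpow_add hd c]
          congr 1; ring
  set D := Metric.diam (univ : Set X) + 1 with hD
  have hD0 : 0 < D := by have := Metric.diam_nonneg (s := (univ : Set X)); linarith
  have outer (x : X) : ∫⁻ y, ∫⁻ z, (closestOuter X).indicator
      (fun p ↦ ENNReal.ofReal (tripleKernel a b c p)) (x, y, z) ∂μ ∂μ ≤
      ENNReal.ofReal (2 ^ |a| * K) * ENNReal.ofReal (K' * D ^ (a + b + c + d + d)) := by
    calc _ ≤ ∫⁻ y, ENNReal.ofReal (2 ^ |a| * K) *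
          ENNReal.ofReal (dist y x ^ (a + b + c + d)) ∂μ := by
          refine lintegral_mono_ae ?_
          filter_upwards [compl_mem_ae_iff.2 (measure_singleton (μ := μ) x)] with y hy
          exact inner x y hy
      _ = ENNReal.ofReal (2 ^ |a| * K) *
          ∫⁻ y in closedBall x D, ENNReal.ofReal (dist y x ^ (a + b + c + d)) ∂μ := by
          rw [lintegral_const_mul' _ _ ENNReal.ofReal_ne_top, eq_univ_of_forall
            (s := closedBall x D) fun y ↦ ?_, Measure.restrict_univ]
          have := Metric.dist_le_diam_of_mem (Bornology.isBounded_univ.2 ‹_›)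
            (mem_univ y) (mem_univ x)
          exact mem_closedBall.2 (by linarith)
      _ ≤ _ := by gcongr; exact hK' x D hD0
  rw [← lintegral_indicator measurableSet_closestOuter]
  refine ((lintegral_prod_le _).trans (lintegral_mono fun x ↦
    (lintegral_prod_le _).trans (outer x))).trans_lt ?_
  rw [lintegral_const]
  exact ENNReal.mul_lt_top (ENNReal.mul_lt_top ENNReal.ofReal_lt_top ENNReal.ofReal_lt_top)
    (measure_lt_top μ univ)

theorem IsAhlforsRegular.lintegral_tripleKernel_lt_top [BoundedSpace X] [SecondCountableTopology X]
    (h : IsAhlforsRegular μ d) {a b c : ℝ} (ha : -d < a) (hb : -d < b) (hc : -d < c)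
    (habc : -(2 * d) < a + b + c) :
    ∫⁻ p, ENNReal.ofReal (tripleKernel a b c p) ∂μ.prod (μ.prod μ) < ∞ := by
  set ν := μ.prod (μ.prod μ)
  set σ : X × X × X → X × X × X := fun p ↦ (p.2.1, p.2.2, p.1)
  have hσ : MeasurePreserving σ ν ν := measurePreserving_rotate μ
  have hcover : univ ⊆ closestOuter X ∪ (σ ⁻¹' closestOuter X ∪ σ ⁻¹' (σ ⁻¹' closestOuter X)) := by
    rintro ⟨x, y, z⟩ -
    simp only [closestOuter, σ, mem_union, mem_inter_iff, mem_preimage, mem_ofPred_eq]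
    grind
  have hmeas (a b c : ℝ) : Measurable fun p : X × X × X ↦ ENNReal.ofReal (tripleKernel a b c p) :=
    (measurable_tripleKernel a b c).ennreal_ofReal
  have rot (a b c : ℝ) {s : Set (X × X × X)} (hs : MeasurableSet s) :
      ∫⁻ p in σ ⁻¹' s, ENNReal.ofReal (tripleKernel a b c p) ∂ν =
        ∫⁻ p in s, ENNReal.ofReal (tripleKernel b c a p) ∂ν := by
    rw [← hσ.setLIntegral_comp_preimage hs (hmeas b c a)]
    simp only [σ, tripleKernel_rotate]
  have hm := measurableSet_closestOuter (X := X)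
  rw [← setLIntegral_univ]
  refine ((lintegral_mono_set hcover).trans ((lintegral_union_le _ _ _).trans
    (add_le_add_right (lintegral_union_le _ _ _) _))).trans_lt ?_
  rw [rot a b c (hσ.measurable hm), rot b c a hm, rot a b c hm]
  exact ENNReal.add_lt_top.2 ⟨h.setLIntegral_closestOuter_lt_top hb habc,
    ENNReal.add_lt_top.2 ⟨h.setLIntegral_closestOuter_lt_top hc (by linarith),
      h.setLIntegral_closestOuter_lt_top ha (by linarith)⟩⟩

theorem measurableSet_twoScaleSet [SecondCountableTopology X] (ε r R : ℝ) :
    MeasurableSet (twoScaleSet X ε r R) := by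
  simp only [twoScaleSet, Set.mem_sdiff, mem_closedBall]
  measurability

theorem measure_twoScaleSet_le [SecondCountableTopology X] {C r : ℝ}
    (hC : ∀ x, μ.real (closedBall x r) ≤ C) (ε R : ℝ) :
    (μ.prod (μ.prod μ)) (twoScaleSet X ε r R) ≤ ENNReal.ofReal C * μ univ * μ univ := by
  rw [Measure.prod_apply (measurableSet_twoScaleSet ε r R), ← lintegral_const]
  refine lintegral_mono fun x ↦ ?_
  calc (μ.prod μ) (Prod.mk x ⁻¹' twoScaleSet X ε r R) ≤ (μ.prod μ) (closedBall x r ×ˢ univ) :=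
        measure_mono fun p hp ↦ ⟨hp.1.1, trivial⟩
    _ ≤ _ := by
        rw [Measure.prod_prod, ← ofReal_measureReal]
        gcongr
        exact hC x

theorem le_measure_twoScaleSet [SecondCountableTopology X] {ε r R A B : ℝ}
    (hA : ∀ x, ENNReal.ofReal A ≤ μ (closedBall x r \ closedBall x (ε * r)))
    (hB : ∀ x, ENNReal.ofReal B ≤ μ (closedBall x R \ closedBall x (ε * R))) :
    ENNReal.ofReal A * ENNReal.ofReal B * μ univ ≤ (μ.prod (μ.prod μ)) (twoScaleSet X ε r R) := by
  rw [Measure.prod_apply (measurableSet_twoScaleSet ε r R), ← lintegral_const]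
  refine lintegral_mono fun x ↦ ?_
  calc ENNReal.ofReal A * ENNReal.ofReal B ≤ μ (closedBall x r \ closedBall x (ε * r)) *
        μ (closedBall x R \ closedBall x (ε * R)) := mul_le_mul' (hA x) (hB x)
    _ = (μ.prod μ) (Prod.mk x ⁻¹' twoScaleSet X ε r R) := (Measure.prod_prod _ _).symm

theorem IsAhlforsRegular.exists_le_setLIntegral_twoScaleSet [SecondCountableTopology X]
    (h : IsAhlforsRegular μ d) (a b c : ℝ) :
    ∃ ε, 0 < ε ∧ ε < 1 ∧ ∃ κ, 0 < κ ∧ ∀ r R, 0 < r → r ≤ ε / 2 * R → R ≤ 1 →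
      ENNReal.ofReal (κ * (r ^ (c + d) * R ^ (a + b + d))) * μ univ ≤
        ∫⁻ p in twoScaleSet X ε r R, ENNReal.ofReal (tripleKernel a b c p)
          ∂μ.prod (μ.prod μ) := by
  obtain ⟨ε, hε0, hε1, κ, hκ0, hκ⟩ := h.exists_annulus_ge
  set L := (2 / ε) ^ |c| * (2 / ε) ^ |a| * (2 / ε) ^ |b|
  have hL : 0 < L := by positivity
  refine ⟨ε, hε0, hε1, L⁻¹ * κ ^ 2, by positivity, fun r R hr hrR hR1 ↦ ?_⟩
  have hR : 0 < R := pos_of_mul_pos_right (hr.trans_le hrR) (by positivity)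
  have hr1 : r ≤ 1 := hrR.trans ((mul_le_of_le_one_left hR.le (by linarith)).trans hR1)
  calc ENNReal.ofReal (L⁻¹ * κ ^ 2 * (r ^ (c + d) * R ^ (a + b + d))) * μ univ
      = ENNReal.ofReal (L⁻¹ * (r ^ c * R ^ a * R ^ b)) *
        (ENNReal.ofReal (κ * r ^ d) * ENNReal.ofReal (κ * R ^ d) * μ univ) := by
        rw [← mul_assoc (ENNReal.ofReal _), ← ENNReal.ofReal_mul (by positivity),
          ← ENNReal.ofReal_mul (by positivity),
          Real.rpow_add hr c d, Real.rpow_add hR (a + b) d, Real.rpow_add hR a b]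
        congr 2; ring
    _ ≤ ENNReal.ofReal (L⁻¹ * (r ^ c * R ^ a * R ^ b)) *
        (μ.prod (μ.prod μ)) (twoScaleSet X ε r R) := by
        gcongr
        exact le_measure_twoScaleSet (fun x ↦ hκ x r hr hr1) (fun x ↦ hκ x R hR hR1)
    _ ≤ _ := by
        rw [← setLIntegral_const]
        refine setLIntegral_mono' (measurableSet_twoScaleSet ε r R) fun p hp ↦
          ENNReal.ofReal_le_ofReal ?_
        rw [inv_mul_le_iff₀ hL]
        exact le_tripleKernel_of_mem_twoScaleSet a b c hε0 hε1 hr hrR hp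

theorem IsAhlforsRegular.tendsto_setLIntegral_twoScaleSet [SecondCountableTopology X]
    (h : IsAhlforsRegular μ d) {f : X × X × X → ℝ≥0∞}
    (hf : ∫⁻ p, f p ∂μ.prod (μ.prod μ) ≠ ∞) (ε : ℝ) (R : ℝ → ℝ) :
    Tendsto (fun r ↦ ∫⁻ p in twoScaleSet X ε r (R r), f p ∂μ.prod (μ.prod μ))
      (𝓝[>] 0) (𝓝 0) := by
  obtain ⟨C, -, hC⟩ := h.upper
  refine tendsto_setLIntegral_zero hf ?_
  have hlim : Tendsto (fun r : ℝ ↦ ENNReal.ofReal (C * r ^ d) * μ univ * μ univ) (𝓝[>] 0)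
      (𝓝 0) := by
    have := ENNReal.Tendsto.mul_const (b := μ univ) (ENNReal.Tendsto.mul_const (b := μ univ)
      (ENNReal.tendsto_ofReal (tendsto_const_mul_rpow_nhdsGT_zero C h.pos))
      (.inr (measure_ne_top μ univ))) (.inr (measure_ne_top μ univ))
    simpa using this
  refine tendsto_of_tendsto_of_tendsto_of_le_of_le' tendsto_const_nhds hlim
    (.of_forall fun _ ↦ zero_le) ?_
  filter_upwards [self_mem_nhdsWithin] with r hr
  exact measure_twoScaleSet_le (fun x ↦ hC x r hr) ε _

theorem IsAhlforsRegular.exponents_of_lintegral_tripleKernel_ne_top [SecondCountableTopology X]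
    [Nonempty X] (h : IsAhlforsRegular μ d) {a b c : ℝ}
    (hf : ∫⁻ p, ENNReal.ofReal (tripleKernel a b c p) ∂μ.prod (μ.prod μ) ≠ ∞) :
    -d < c ∧ -(2 * d) < a + b + c := by
  obtain ⟨ε, hε0, hε1, κ, hκ0, hκ⟩ := h.exists_le_setLIntegral_twoScaleSet a b c
  have huniv : μ univ ≠ 0 := by
    obtain ⟨c, hc0, hc⟩ := h.lower
    have h1 := (hc (Classical.arbitrary X) 1 one_pos le_rfl).trans
      (measureReal_mono (subset_univ _))
    rw [Real.one_rpow, mul_one] at h1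
    exact (ENNReal.toReal_pos_iff.1 (hc0.trans_le h1)).1.ne'
  have not_bounded_below (R : ℝ → ℝ) (m : ℝ) (hm : 0 < m) (hR : ∀ r, 0 < r → r ≤ ε / 2 →
      r ≤ ε / 2 * R r ∧ R r ≤ 1 ∧ m ≤ r ^ (c + d) * R r ^ (a + b + d)) : False := by
    have hle : ENNReal.ofReal (κ * m) * μ univ ≤ 0 := by
      refine ge_of_tendsto (h.tendsto_setLIntegral_twoScaleSet hf ε R) ?_
      filter_upwards [Ioc_mem_nhdsGT (half_pos hε0)] with r hr
      obtain ⟨h1, h2, h3⟩ := hR r hr.1 hr.2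
      refine le_trans ?_ (hκ r (R r) hr.1 h1 h2)
      gcongr
    exact mul_ne_zero (ENNReal.ofReal_pos.2 (by positivity)).ne' huniv (le_antisymm hle zero_le)
  constructor
  · by_contra! hc
    refine not_bounded_below (fun _ ↦ 1) 1 one_pos fun r hr hrε ↦ ⟨by simpa using hrε, le_rfl, ?_⟩
    rw [Real.one_rpow, mul_one]
    exact Real.one_le_rpow_of_pos_of_le_one_of_nonpos hr (by linarith) (by linarith)
  · by_contra! habc
    refine not_bounded_below (fun r ↦ 2 / ε * r) ((2 / ε) ^ (a + b + d)) (by positivity)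
      fun r hr hrε ↦ ⟨by field_simp; rfl, ?_, ?_⟩
    · rw [div_mul_eq_mul_div, div_le_one hε0]; linarith
    · rw [Real.mul_rpow (by positivity) hr.le, mul_left_comm, ← Real.rpow_add hr]
      exact le_mul_of_one_le_right (by positivity)
        (Real.one_le_rpow_of_pos_of_le_one_of_nonpos hr (by linarith) (by linarith))

theorem IsAhlforsRegular.integrable_tripleKernel_iff [BoundedSpace X] [SecondCountableTopology X]
    [Nonempty X] (h : IsAhlforsRegular μ d) (a b c : ℝ) :
    Integrable (tripleKernel a b c) (μ.prod (μ.prod μ)) ↔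
      -d < a ∧ -d < b ∧ -d < c ∧ -(2 * d) < a + b + c := by
  have hiff (a b c : ℝ) : Integrable (tripleKernel (X := X) a b c) (μ.prod (μ.prod μ)) ↔
      ∫⁻ p, ENNReal.ofReal (tripleKernel a b c p) ∂μ.prod (μ.prod μ) ≠ ∞ := by
    rw [← lt_top_iff_ne_top, ← hasFiniteIntegral_iff_ofReal
      (.of_forall (tripleKernel_nonneg a b c))]
    exact and_iff_right (measurable_tripleKernel a b c).aestronglyMeasurable
  have hrot (a b c : ℝ) : Integrable (tripleKernel (X := X) a b c) (μ.prod (μ.prod μ)) ↔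
      Integrable (tripleKernel b c a) (μ.prod (μ.prod μ)) := by
    rw [← (measurePreserving_rotate μ).integrable_comp
      (measurable_tripleKernel b c a).aestronglyMeasurable]
    exact Iff.of_eq (congrArg (Integrable · _) (funext fun p ↦ (tripleKernel_rotate a b c p).symm))
  refine ⟨fun hf ↦ ?_, fun ⟨ha, hb, hc, habc⟩ ↦
    (hiff a b c).2 (h.lintegral_tripleKernel_lt_top ha hb hc habc).ne⟩
  have hf₁ := (hrot a b c).1 hf
  have hf₂ := (hrot b c a).1 hf₁
  exact ⟨(h.exponents_of_lintegral_tripleKernel_ne_top ((hiff _ _ _).1 hf₁)).1,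
    (h.exponents_of_lintegral_tripleKernel_ne_top ((hiff _ _ _).1 hf₂)).1,
    h.exponents_of_lintegral_tripleKernel_ne_top ((hiff _ _ _).1 hf)⟩

end AhlforsRegular

/-- the integral defining `K_α` converges absolutely iff
`Re α_j > -(n-1)` for `j = 1,2,3` and `Re (α₁+α₂+α₃) > -2(n-1)`. -/
theorem integrable_dist_rpow_iff (n : ℕ) (hn : 4 ≤ n) (α₁ α₂ α₃ : ℂ) :
    Integrable
      (fun p : unitSphere n × unitSphere n × unitSphere n =>
        dist (p.1 : EuclideanSpace ℝ (Fin n)) (p.2.1 : EuclideanSpace ℝ (Fin n)) ^ α₃.re *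
        dist (p.2.1 : EuclideanSpace ℝ (Fin n)) (p.2.2 : EuclideanSpace ℝ (Fin n)) ^ α₁.re *
        dist (p.2.2 : EuclideanSpace ℝ (Fin n)) (p.1 : EuclideanSpace ℝ (Fin n)) ^ α₂.re)
      ((sphereMeasure n).prod ((sphereMeasure n).prod (sphereMeasure n))) ↔
    (-((n : ℝ) - 1) < α₁.re ∧ -((n : ℝ) - 1) < α₂.re ∧ -((n : ℝ) - 1) < α₃.re ∧
      -(2 * ((n : ℝ) - 1)) < (α₁ + α₂ + α₃).re) := by
  have hreg : IsAhlforsRegular (sphereMeasure n) ((n : ℝ) - 1) := by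
    have := isAhlforsRegular_toSphere (volume : Measure (EuclideanSpace ℝ (Fin n)))
      (by rw [finrank_euclideanSpace_fin]; omega)
    rwa [finrank_euclideanSpace_fin] at this
  have : IsFiniteMeasure (sphereMeasure n) := by unfold sphereMeasure; infer_instance
  have : Nonempty (Fin n) := ⟨0, by omega⟩
  have : Nonempty (unitSphere n) := (NormedSpace.sphere_nonempty.2 zero_le_one).to_subtype
  rw [Complex.add_re, Complex.add_re]
  exact hreg.integrable_tripleKernel_iff α₁.re α₂.re α₃.re
end

section
/- Let n ≥ 1 and let P : ℝⁿ×ℝⁿ×ℝⁿ → ℝ be a polynomial function whose restriction p to S×S×S satisfies p(kx, ky, kz) = p(x,y,z) for every k ∈ SO(n) and all (x,y,z) ∈ S×S×S. Then there exists a polynomial function Q : ℝⁿ×ℝⁿ×ℝⁿ → ℝ such that Q(kx, ky, kz) = Q(x,y,z) for every k ∈ SO(n) and all x,y,z ∈ ℝⁿ, and whose restriction to S×S×S equals p. -/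
open MvPolynomial

/-- Evaluation of a polynomial in the `3n` coordinates at a triple of vectors of `ℝⁿ`. -/
noncomputable def evalTriple {n : ℕ} (P : MvPolynomial (Fin 3 × Fin n) ℝ)
    (x y z : EuclideanSpace ℝ (Fin n)) : ℝ :=
  MvPolynomial.eval (fun q : Fin 3 × Fin n => ![x, y, z] q.1 q.2) P

open Metric MeasureTheory

section PolynomialTriples

variable {n : ℕ}

local notation "E" => EuclideanSpace ℝ (Fin n)

/-- Substituting linear forms does not increase the total degree. -/
theorem totalDegree_aeval_le_of_totalDegree_le_one {σ τ R : Type*} [CommSemiring R]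
    (f : σ → MvPolynomial τ R) (hf : ∀ i, (f i).totalDegree ≤ 1) (p : MvPolynomial σ R) :
    (aeval f p).totalDegree ≤ p.totalDegree := by
  rw [aeval_def, eval₂_eq]
  refine totalDegree_finsetSum_le fun d hd => ?_
  calc (algebraMap R (MvPolynomial τ R) (p.coeff d) * ∏ i ∈ d.support, f i ^ d i).totalDegree
      ≤ 0 + ∑ i ∈ d.support, d i := by
        refine (totalDegree_mul _ _).trans (add_le_add (totalDegree_C _).le ?_)
        refine (totalDegree_finsetProd _ _).trans (Finset.sum_le_sum fun i _ => ?_)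
        exact (totalDegree_pow _ _).trans (by simpa using Nat.mul_le_mul_left (d i) (hf i))
    _ ≤ p.totalDegree := by
        rw [zero_add]
        exact le_totalDegree hd

theorem evalTriple_add (p q : MvPolynomial (Fin 3 × Fin n) ℝ) (x y z : E) :
    evalTriple (p + q) x y z = evalTriple p x y z + evalTriple q x y z :=
  map_add _ p q

theorem evalTriple_sub (p q : MvPolynomial (Fin 3 × Fin n) ℝ) (x y z : E) :
    evalTriple (p - q) x y z = evalTriple p x y z - evalTriple q x y z :=
  map_sub _ p q

theorem evalTriple_mul (p q : MvPolynomial (Fin 3 × Fin n) ℝ) (x y z : E) :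
    evalTriple (p * q) x y z = evalTriple p x y z * evalTriple q x y z :=
  map_mul _ p q

theorem evalTriple_smul (c : ℝ) (p : MvPolynomial (Fin 3 × Fin n) ℝ) (x y z : E) :
    evalTriple (c • p) x y z = c * evalTriple p x y z :=
  smul_eval _ p c

theorem continuous_evalTriple (p : MvPolynomial (Fin 3 × Fin n) ℝ) :
    Continuous fun t : E × E × E => evalTriple p t.1 t.2.1 t.2.2 := by
  refine (MvPolynomial.continuous_eval p).comp (continuous_pi fun q => ?_)
  obtain ⟨i, j⟩ := q
  fin_cases i <;> simp <;> fun_prop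

/-- The polynomial obtained from `p` by applying a linear isometry to each of the three
vector variables. -/
noncomputable def substIsometry (k : E ≃ₗᵢ[ℝ] E) :
    MvPolynomial (Fin 3 × Fin n) ℝ →ₐ[ℝ] MvPolynomial (Fin 3 × Fin n) ℝ :=
  aeval fun q => ∑ j, C (k (EuclideanSpace.single j 1) q.2) * X (q.1, j)

theorem LinearIsometryEquiv.apply_eq_sum_single (k : E ≃ₗᵢ[ℝ] E) (x : E) (i : Fin n) :
    k x i = ∑ j, k (EuclideanSpace.single j 1) i * x j := by
  have h : x = ∑ j, x j • EuclideanSpace.single j (1 : ℝ) := by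
    simpa using ((EuclideanSpace.basisFun (Fin n) ℝ).sum_repr x).symm
  conv_lhs => rw [h]
  simp [mul_comm]

theorem evalTriple_substIsometry (k : E ≃ₗᵢ[ℝ] E) (p : MvPolynomial (Fin 3 × Fin n) ℝ)
    (x y z : E) :
    evalTriple (substIsometry k p) x y z = evalTriple p (k x) (k y) (k z) := by
  induction p using MvPolynomial.induction_on with
  | C a => simp [evalTriple, substIsometry]
  | add p q hp hq => rw [map_add, evalTriple_add, evalTriple_add, hp, hq]
  | mul_X p q hp =>
    obtain ⟨i, j⟩ := q
    rw [map_mul, evalTriple_mul, evalTriple_mul, hp]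
    congr 1
    fin_cases i <;>
      simpa [evalTriple, substIsometry] using
        (LinearIsometryEquiv.apply_eq_sum_single k _ j).symm

theorem totalDegree_substIsometry_le (k : E ≃ₗᵢ[ℝ] E) (p : MvPolynomial (Fin 3 × Fin n) ℝ) :
    (substIsometry k p).totalDegree ≤ p.totalDegree := by
  refine totalDegree_aeval_le_of_totalDegree_le_one _ (fun q => ?_) p
  refine totalDegree_finsetSum_le fun j _ => (totalDegree_mul _ _).trans ?_
  simp

theorem integrableOn_evalTriple_mul (p q : MvPolynomial (Fin 3 × Fin n) ℝ) :
    IntegrableOn (fun t : E × E × E =>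
      evalTriple p t.1 t.2.1 t.2.2 * evalTriple q t.1 t.2.1 t.2.2) (ball 0 1) :=
  (((continuous_evalTriple p).mul (continuous_evalTriple q)).continuousOn.integrableOn_compact
    (isCompact_closedBall 0 1)).mono_set ball_subset_closedBall

variable (n) in
/-- The `L²` inner product of polynomials over the product of three unit balls. -/
noncomputable def ballForm : LinearMap.BilinForm ℝ (MvPolynomial (Fin 3 × Fin n) ℝ) :=
  LinearMap.mk₂ ℝ
    (fun p q => ∫ t in ball (0 : E × E × E) 1,
      evalTriple p t.1 t.2.1 t.2.2 * evalTriple q t.1 t.2.1 t.2.2)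
    (fun p p' q => by
      simp only [evalTriple_add, add_mul]
      exact integral_add (integrableOn_evalTriple_mul p q) (integrableOn_evalTriple_mul p' q))
    (fun c p q => by
      simp only [evalTriple_smul, mul_assoc, integral_const_mul, smul_eq_mul])
    (fun p q q' => by
      simp only [evalTriple_add, mul_add]
      exact integral_add (integrableOn_evalTriple_mul p q) (integrableOn_evalTriple_mul p q'))
    (fun c p q => by
      simp only [evalTriple_smul, mul_left_comm _ c, integral_const_mul, smul_eq_mul])

theorem ballForm_apply (p q : MvPolynomial (Fin 3 × Fin n) ℝ) :
    ballForm n p q = ∫ t in ball (0 : E × E × E) 1,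
      evalTriple p t.1 t.2.1 t.2.2 * evalTriple q t.1 t.2.1 t.2.2 := rfl

theorem ballForm_isSymm : (ballForm n).IsSymm :=
  ⟨fun p q => by simp only [ballForm_apply, mul_comm]⟩

theorem eq_zero_of_evalTriple_eq_zero_on_ball {p : MvPolynomial (Fin 3 × Fin n) ℝ}
    (h : ∀ t ∈ ball (0 : E × E × E) 1, evalTriple p t.1 t.2.1 t.2.2 = 0) : p = 0 := by
  let F : (Fin 3 × Fin n → ℝ) → E × E × E := fun v =>
    (WithLp.toLp 2 fun j => v (0, j), WithLp.toLp 2 fun j => v (1, j),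
      WithLp.toLp 2 fun j => v (2, j))
  have hF : Continuous F := by fun_prop
  have hF0 : F 0 = 0 := rfl
  obtain ⟨ε, hε, hsub⟩ := Metric.mem_nhds_iff.1
    (hF.continuousAt.preimage_mem_nhds (x := 0) (hF0 ▸ ball_mem_nhds (0 : E × E × E) one_pos))
  refine funext_set (fun _ => ball (0 : ℝ) ε) (fun _ => ?_) fun v hv => ?_
  · rw [Real.ball_eq_Ioo]
    exact Set.Ioo_infinite (by linarith)
  · have hv' : v ∈ ball (0 : Fin 3 × Fin n → ℝ) ε := by
      rwa [ball_pi _ hε]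
    have := h _ (hsub hv')
    rw [map_zero, ← this]
    unfold evalTriple
    congr 2
    funext q
    obtain ⟨i, j⟩ := q
    fin_cases i <;> rfl

theorem eq_zero_of_ballForm_self_eq_zero {p : MvPolynomial (Fin 3 × Fin n) ℝ}
    (h : ballForm n p p = 0) : p = 0 := by
  rw [ballForm_apply, integral_eq_zero_iff_of_nonneg (fun t => mul_self_nonneg _)
    (integrableOn_evalTriple_mul p p)] at h
  refine eq_zero_of_evalTriple_eq_zero_on_ball fun t ht => mul_self_eq_zero.1 ?_
  have : (volume : Measure (E × E)).IsOpenPosMeasure := Measure.prod.instIsOpenPosMeasure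
  have : (volume : Measure (E × E × E)).IsOpenPosMeasure := Measure.prod.instIsOpenPosMeasure
  exact Measure.eqOn_open_of_ae_eq h isOpen_ball
    ((continuous_evalTriple p).mul (continuous_evalTriple p)).continuousOn
    continuousOn_const ht

theorem ballForm_substIsometry_right (k : E ≃ₗᵢ[ℝ] E) (p q : MvPolynomial (Fin 3 × Fin n) ℝ) :
    ballForm n p (substIsometry k q) = ballForm n (substIsometry k.symm p) q := by
  have hk : MeasurePreserving (Prod.map k (Prod.map k k)) (volume : Measure (E × E × E)) volume :=
    k.measurePreserving.prod (k.measurePreserving.prod k.measurePreserving)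
  have hemb : MeasurableEmbedding (Prod.map k (Prod.map k k) : E × E × E → E × E × E) :=
    (k.toHomeomorph.prodCongr
      (k.toHomeomorph.prodCongr k.toHomeomorph)).measurableEmbedding
  have hball : Prod.map k (Prod.map k k) ⁻¹' ball (0 : E × E × E) 1 = ball 0 1 := by
    ext t
    simp [Prod.norm_def]
  rw [ballForm_apply, ballForm_apply, ← hk.setIntegral_preimage_emb hemb
    (fun t => evalTriple (substIsometry k.symm p) t.1 t.2.1 t.2.2 * evalTriple q t.1 t.2.1 t.2.2),
    hball]
  simp [evalTriple_substIsometry]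

variable (n) in
/-- Polynomials of total degree at most `d` that vanish on the product of three unit spheres. -/
noncomputable def vanishingOnSpheres (d : ℕ) : Submodule ℝ (MvPolynomial (Fin 3 × Fin n) ℝ) where
  carrier := {p | p.totalDegree ≤ d ∧
    ∀ x y z : E, ‖x‖ = 1 → ‖y‖ = 1 → ‖z‖ = 1 → evalTriple p x y z = 0}
  add_mem' {p q} hp hq := ⟨(totalDegree_add p q).trans (max_le hp.1 hq.1), fun x y z hx hy hz => by
    rw [evalTriple_add, hp.2 x y z hx hy hz, hq.2 x y z hx hy hz, add_zero]⟩
  zero_mem' := ⟨by simp, fun x y z _ _ _ => map_zero _⟩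
  smul_mem' c p hp := ⟨(totalDegree_smul_le c p).trans hp.1, fun x y z hx hy hz => by
    rw [evalTriple_smul, hp.2 x y z hx hy hz, mul_zero]⟩

instance (n d : ℕ) : Module.Finite ℝ (vanishingOnSpheres n d) :=
  Submodule.finiteDimensional_of_le (S₂ := restrictTotalDegree (Fin 3 × Fin n) ℝ d)
    fun p hp => (mem_restrictTotalDegree _ _ p).2 hp.1

theorem substIsometry_mem_vanishingOnSpheres (k : E ≃ₗᵢ[ℝ] E) {d : ℕ}
    {p : MvPolynomial (Fin 3 × Fin n) ℝ} (hp : p ∈ vanishingOnSpheres n d) :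
    substIsometry k p ∈ vanishingOnSpheres n d :=
  ⟨(totalDegree_substIsometry_le k p).trans hp.1, fun x y z hx hy hz => by
    rw [evalTriple_substIsometry]
    exact hp.2 _ _ _ (by simpa) (by simpa) (by simpa)⟩

theorem eq_zero_of_mem_of_mem_orthogonal {W : Submodule ℝ (MvPolynomial (Fin 3 × Fin n) ℝ)}
    {p : MvPolynomial (Fin 3 × Fin n) ℝ} (hp : p ∈ W) (hp' : p ∈ (ballForm n).orthogonal W) :
    p = 0 :=
  eq_zero_of_ballForm_self_eq_zero (hp' p hp)

theorem exists_sub_mem_orthogonal_ballForm (W : Submodule ℝ (MvPolynomial (Fin 3 × Fin n) ℝ))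
    [Module.Finite ℝ W] (p : MvPolynomial (Fin 3 × Fin n) ℝ) :
    ∃ r ∈ W, p - r ∈ (ballForm n).orthogonal W := by
  have hW : ((ballForm n).restrict W).Nondegenerate :=
    (ballForm n).nondegenerate_restrict_of_disjoint_orthogonal ballForm_isSymm.isRefl
      (Submodule.disjoint_def.2 fun _ => eq_zero_of_mem_of_mem_orthogonal)
  let r := (((ballForm n).restrict W).toDual hW).symm (ballForm n p ∘ₗ W.subtype)
  refine ⟨r, r.2, fun w hw => ?_⟩
  have h : ballForm n r w = ballForm n p w :=
    ((ballForm n).restrict W).apply_toDual_symm_apply (hB := hW)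
      (ballForm n p ∘ₗ W.subtype) ⟨w, hw⟩
  change ballForm n w (p - r) = 0
  rw [ballForm_isSymm.eq, map_sub, LinearMap.sub_apply, h, sub_self]

end PolynomialTriples

/-- an `SO(n)`-invariant polynomial function on `S×S×S` is the restriction of an
`SO(n)`-invariant polynomial on `ℝⁿ×ℝⁿ×ℝⁿ`.  Here `SO(n)` is realized as the group of linear
isometries of `ℝⁿ` of determinant `1`. -/
theorem invariant_polynomial_extension (n : ℕ) (hn : 1 ≤ n)
    (P : MvPolynomial (Fin 3 × Fin n) ℝ)
    (hP : ∀ k : EuclideanSpace ℝ (Fin n) ≃ₗᵢ[ℝ] EuclideanSpace ℝ (Fin n),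
      k.toLinearEquiv.det = 1 →
      ∀ x y z : EuclideanSpace ℝ (Fin n), ‖x‖ = 1 → ‖y‖ = 1 → ‖z‖ = 1 →
        evalTriple P (k x) (k y) (k z) = evalTriple P x y z) :
    ∃ Q : MvPolynomial (Fin 3 × Fin n) ℝ,
      (∀ k : EuclideanSpace ℝ (Fin n) ≃ₗᵢ[ℝ] EuclideanSpace ℝ (Fin n),
        k.toLinearEquiv.det = 1 →
        ∀ x y z : EuclideanSpace ℝ (Fin n),
          evalTriple Q (k x) (k y) (k z) = evalTriple Q x y z) ∧
      (∀ x y z : EuclideanSpace ℝ (Fin n), ‖x‖ = 1 → ‖y‖ = 1 → ‖z‖ = 1 →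
        evalTriple Q x y z = evalTriple P x y z) := by
  set W := vanishingOnSpheres n P.totalDegree
  obtain ⟨R, hR, hQ⟩ := exists_sub_mem_orthogonal_ballForm W P
  set Q := P - R with hQdef
  have hsum : R + Q = P := by rw [hQdef, add_sub_cancel]
  refine ⟨Q, fun k hk x y z => ?_, fun x y z hx hy hz => ?_⟩
  · have hkP : substIsometry k P - P ∈ W :=
      ⟨(totalDegree_sub _ _).trans (max_le (totalDegree_substIsometry_le k P) le_rfl),
        fun x y z hx hy hz => by
          rw [evalTriple_sub, evalTriple_substIsometry, hP k hk x y z hx hy hz, sub_self]⟩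
    have hmem : substIsometry k Q - Q ∈ W := by
      have h := W.add_mem (W.sub_mem hkP (substIsometry_mem_vanishingOnSpheres k hR)) hR
      rw [← hsum, map_add] at h
      convert h using 1
      ring
    have horth : substIsometry k Q - Q ∈ (ballForm n).orthogonal W := by
      refine Submodule.sub_mem _ (fun w hw => ?_) hQ
      change ballForm n w (substIsometry k Q) = 0
      rw [ballForm_substIsometry_right]
      exact hQ _ (substIsometry_mem_vanishingOnSpheres k.symm hw)
    rw [← evalTriple_substIsometry,
      sub_eq_zero.1 (eq_zero_of_mem_of_mem_orthogonal hmem horth)]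
  · rw [← hsum, evalTriple_add, hR.2 x y z hx hy hz, zero_add]
end

section
/- Let n ≥ 4. For every polynomial function p on S×S×S (i.e. the restriction to S×S×S of a real polynomial in the 3n coordinates) such that p(kx, ky, kz) = p(x,y,z) for all k ∈ SO(n) and all (x,y,z) ∈ S×S×S, there exists a real polynomial q in three variables such that p(x,y,z) = q(|y−z|², |z−x|², |x−y|²) for all (x,y,z) ∈ S×S×S. In other words, the algebra of SO(n)-invariant polynomial functions on S×S×S is generated by |x−y|², |y−z|², |z−x|². -/
open MvPolynomial

section Isometries

variable {n : ℕ}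

local notation "E" => EuclideanSpace ℝ (Fin n)

lemma exists_unit_orthogonal_triple (hn : 4 ≤ n) (x y z : E) :
    ∃ v : E, ‖v‖ = 1 ∧ inner ℝ v x = 0 ∧ inner ℝ v y = 0 ∧ inner ℝ v z = 0 := by
  have hlt : Module.finrank ℝ (Submodule.span ℝ (Set.range ![x, y, z])) < Module.finrank ℝ E := by
    refine (finrank_range_le_card (R := ℝ) ![x, y, z]).trans_lt ?_
    rw [Fintype.card_fin, finrank_euclideanSpace, Fintype.card_fin]
    exact hn
  have hne : (Submodule.span ℝ (Set.range ![x, y, z]))ᗮ ≠ ⊥ := by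
    intro h
    rw [Submodule.orthogonal_eq_bot_iff] at h
    rw [h, finrank_top] at hlt
    exact lt_irrefl _ hlt
  obtain ⟨v, hv, hv0⟩ := Submodule.exists_mem_ne_zero_of_ne_bot hne
  have key (i : Fin 3) : inner ℝ v (![x, y, z] i) = 0 :=
    Submodule.inner_left_of_mem_orthogonal (Submodule.subset_span (Set.mem_range_self i)) hv
  refine ⟨‖v‖⁻¹ • v, norm_smul_inv_norm hv0, ?_, ?_, ?_⟩
  · simpa [inner_smul_left] using Or.inr (key 0)
  · simpa [inner_smul_left] using Or.inr (key 1)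
  · simpa [inner_smul_left] using Or.inr (key 2)

lemma det_reflection_hyperplane {v : E} (hv : v ≠ 0) :
    (ℝ ∙ v)ᗮ.reflection.toLinearEquiv.det = -1 := by
  have := Submodule.linearEquiv_det_reflection (ℝ ∙ v)ᗮ
  rw [Submodule.orthogonal_orthogonal, finrank_span_singleton hv, pow_one] at this
  exact this

lemma reflection_hyperplane_eq_self {v x : E} (h : inner ℝ v x = 0) :
    (ℝ ∙ v)ᗮ.reflection x = x :=
  Submodule.reflection_mem_subspace_eq_self (Submodule.mem_orthogonal_singleton_iff_inner_right.2 h)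

/-- Invariance under `SO(n)` implies invariance under hyperplane reflections when `4 ≤ n`. -/
lemma apply_reflection_of_invariant (hn : 4 ≤ n) {f : E → E → E → ℝ}
    (hf : ∀ k : E ≃ₗᵢ[ℝ] E, k.toLinearEquiv.det = 1 →
      ∀ x y z : E, ‖x‖ = 1 → ‖y‖ = 1 → ‖z‖ = 1 → f (k x) (k y) (k z) = f x y z)
    (u : E) {x y z : E} (hx : ‖x‖ = 1) (hy : ‖y‖ = 1) (hz : ‖z‖ = 1) :
    f ((ℝ ∙ u)ᗮ.reflection x) ((ℝ ∙ u)ᗮ.reflection y) ((ℝ ∙ u)ᗮ.reflection z) = f x y z := by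
  by_cases hu : u = 0
  · subst hu
    rw [reflection_hyperplane_eq_self (inner_zero_left _),
      reflection_hyperplane_eq_self (inner_zero_left _),
      reflection_hyperplane_eq_self (inner_zero_left _)]
  obtain ⟨v, hv, hvx, hvy, hvz⟩ := exists_unit_orthogonal_triple hn x y z
  have hv0 : v ≠ 0 := by
    rintro rfl
    simp at hv
  have h := hf ((ℝ ∙ v)ᗮ.reflection.trans (ℝ ∙ u)ᗮ.reflection) (by
    change ((ℝ ∙ v)ᗮ.reflection.toLinearEquiv.trans (ℝ ∙ u)ᗮ.reflection.toLinearEquiv).det = 1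
    rw [← LinearEquiv.mul_eq_trans, map_mul, det_reflection_hyperplane hu,
      det_reflection_hyperplane hv0]
    simp) x y z hx hy hz
  simpa [reflection_hyperplane_eq_self hvx, reflection_hyperplane_eq_self hvy,
    reflection_hyperplane_eq_self hvz] using h

/-- An `SO(n)`-invariant function of three unit vectors depends only on their Gram matrix. -/
lemma eq_of_gram_eq (hn : 4 ≤ n) {f : E → E → E → ℝ}
    (hf : ∀ k : E ≃ₗᵢ[ℝ] E, k.toLinearEquiv.det = 1 →
      ∀ x y z : E, ‖x‖ = 1 → ‖y‖ = 1 → ‖z‖ = 1 → f (k x) (k y) (k z) = f x y z)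
    {x y z x' y' z' : E} (hx : ‖x‖ = 1) (hy : ‖y‖ = 1) (hz : ‖z‖ = 1)
    (hx' : ‖x'‖ = 1) (hy' : ‖y'‖ = 1) (hz' : ‖z'‖ = 1)
    (hxy : inner ℝ x y = inner ℝ x' y') (hxz : inner ℝ x z = inner ℝ x' z')
    (hyz : inner ℝ y z = inner ℝ y' z') : f x y z = f x' y' z' := by
  have fix {p q r : E} (h : inner ℝ r p = inner ℝ r q) : (ℝ ∙ (p - q))ᗮ.reflection r = r := by
    apply reflection_hyperplane_eq_self
    rw [real_inner_comm, inner_sub_right, h, sub_self]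
  rw [← apply_reflection_of_invariant hn hf (x - x') hx hy hz,
    Submodule.reflection_sub (hx.trans hx'.symm)]
  have ixy := (ℝ ∙ (x - x'))ᗮ.reflection.inner_map_map x y
  have ixz := (ℝ ∙ (x - x'))ᗮ.reflection.inner_map_map x z
  have iyz := (ℝ ∙ (x - x'))ᗮ.reflection.inner_map_map y z
  have ny := (ℝ ∙ (x - x'))ᗮ.reflection.norm_map y
  have nz := (ℝ ∙ (x - x'))ᗮ.reflection.norm_map z
  rw [Submodule.reflection_sub (hx.trans hx'.symm)] at ixy ixz
  generalize (ℝ ∙ (x - x'))ᗮ.reflection y = y₁ at *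
  generalize (ℝ ∙ (x - x'))ᗮ.reflection z = z₁ at *
  rw [← apply_reflection_of_invariant hn hf (y₁ - y') hx' (ny.trans hy) (nz.trans hz),
    Submodule.reflection_sub ((ny.trans hy).trans hy'.symm), fix (ixy.trans hxy)]
  have jyz := (ℝ ∙ (y₁ - y'))ᗮ.reflection.inner_map_map y₁ z₁
  have jxz := (ℝ ∙ (y₁ - y'))ᗮ.reflection.inner_map_map x' z₁
  have mz := (ℝ ∙ (y₁ - y'))ᗮ.reflection.norm_map z₁
  rw [Submodule.reflection_sub ((ny.trans hy).trans hy'.symm)] at jyz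
  rw [fix (ixy.trans hxy)] at jxz
  generalize (ℝ ∙ (y₁ - y'))ᗮ.reflection z₁ = z₂ at *
  have hz₂ : ‖z₂‖ = 1 := (mz.trans nz).trans hz
  rw [← apply_reflection_of_invariant hn hf (z₂ - z') hx' hy' hz₂,
    Submodule.reflection_sub (hz₂.trans hz'.symm), fix ((jxz.trans ixz).trans hxz),
    fix ((jyz.trans iyz).trans hyz)]

end Isometries

section NormalForm

variable {n : ℕ}

/-- On triples in normal form, a polynomial in the coordinates becomes, after multiplication by a
power of `1 - a ^ 2`, a combination of `1, s, t, s * t` with coefficients polynomial in the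
entries `a`, `b`, `a * b + s * w` of the Gram matrix. -/
lemma exists_normal_form_expansion (u v r : Fin n → ℝ) (P : MvPolynomial (Fin 3 × Fin n) ℝ) :
    ∃ (m : ℕ) (N₀ N₁ N₂ N₃ : MvPolynomial (Fin 3) ℝ), ∀ a s b w t : ℝ,
      a ^ 2 + s ^ 2 = 1 → b ^ 2 + w ^ 2 + t ^ 2 = 1 →
      (1 - a ^ 2) ^ m * eval (fun q : Fin 3 × Fin n =>
          ![u, fun i => a * u i + s * v i, fun i => b * u i + w * v i + t * r i] q.1 q.2) P =
        eval ![a, b, a * b + s * w] N₀ + eval ![a, b, a * b + s * w] N₁ * s +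
          eval ![a, b, a * b + s * w] N₂ * t + eval ![a, b, a * b + s * w] N₃ * (s * t) := by
  induction P using MvPolynomial.induction_on with
  | C c => exact ⟨0, C c, 0, 0, 0, fun a s b w t _ _ => by simp⟩
  | add P Q hP hQ =>
    obtain ⟨m, M₀, M₁, M₂, M₃, hM⟩ := hP
    obtain ⟨k, N₀, N₁, N₂, N₃, hN⟩ := hQ
    refine ⟨m + k, (1 - X 0 ^ 2) ^ k * M₀ + (1 - X 0 ^ 2) ^ m * N₀,
      (1 - X 0 ^ 2) ^ k * M₁ + (1 - X 0 ^ 2) ^ m * N₁,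
      (1 - X 0 ^ 2) ^ k * M₂ + (1 - X 0 ^ 2) ^ m * N₂,
      (1 - X 0 ^ 2) ^ k * M₃ + (1 - X 0 ^ 2) ^ m * N₃, fun a s b w t h₁ h₂ => ?_⟩
    simp only [map_add, map_mul, map_sub, map_pow, map_one, eval_X, Matrix.cons_val_zero]
    linear_combination (1 - a ^ 2) ^ k * hM a s b w t h₁ h₂ +
      (1 - a ^ 2) ^ m * hN a s b w t h₁ h₂
  | mul_X P p hP =>
    obtain ⟨m, N₀, N₁, N₂, N₃, hN⟩ := hP
    obtain ⟨j, i⟩ := p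
    fin_cases j
    · refine ⟨m, C (u i) * N₀, C (u i) * N₁, C (u i) * N₂, C (u i) * N₃,
        fun a s b w t h₁ h₂ => ?_⟩
      simp only [map_mul, eval_X, eval_C, Fin.zero_eta, Matrix.cons_val_zero]
      linear_combination u i * hN a s b w t h₁ h₂
    · refine ⟨m, C (u i) * X 0 * N₀ + C (v i) * (1 - X 0 ^ 2) * N₁,
        C (u i) * X 0 * N₁ + C (v i) * N₀,
        C (u i) * X 0 * N₂ + C (v i) * (1 - X 0 ^ 2) * N₃,
        C (u i) * X 0 * N₃ + C (v i) * N₂, fun a s b w t h₁ h₂ => ?_⟩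
      simp only [map_add, map_mul, map_sub, map_pow, map_one, eval_X, eval_C, Fin.mk_one,
        Matrix.cons_val_zero, Matrix.cons_val_one]
      linear_combination (a * u i + s * v i) * hN a s b w t h₁ h₂ +
        v i * (eval ![a, b, a * b + s * w] N₁ + eval ![a, b, a * b + s * w] N₃ * t) * h₁
    · let σ : MvPolynomial (Fin 3) ℝ := 1 - X 0 ^ 2
      let δ : MvPolynomial (Fin 3) ℝ := X 2 - X 0 * X 1
      let D : MvPolynomial (Fin 3) ℝ := σ * (1 - X 1 ^ 2) - δ ^ 2
      refine ⟨m + 1,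
        σ * X 1 * C (u i) * N₀ + C (v i) * δ * σ * N₁ + C (r i) * D * N₂,
        σ * X 1 * C (u i) * N₁ + C (v i) * δ * N₀ + C (r i) * D * N₃,
        σ * X 1 * C (u i) * N₂ + C (v i) * δ * σ * N₃ + C (r i) * σ * N₀,
        σ * X 1 * C (u i) * N₃ + C (v i) * δ * N₂ + C (r i) * σ * N₁,
        fun a s b w t h₁ h₂ => ?_⟩
      simp only [σ, δ, D, map_add, map_mul, map_sub, map_pow, map_one, eval_X, eval_C,
        Fin.reduceFinMk, Matrix.cons_val_zero, Matrix.cons_val_one, Matrix.cons_val]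
      linear_combination (1 - a ^ 2) * (b * u i + w * v i + t * r i) * hN a s b w t h₁ h₂ -
        w * v i * (eval ![a, b, a * b + s * w] N₀ + eval ![a, b, a * b + s * w] N₂ * t) * h₁ +
        r i * (eval ![a, b, a * b + s * w] N₂ + eval ![a, b, a * b + s * w] N₃ * s) *
          ((1 - a ^ 2) * h₂ + w ^ 2 * h₁)

local notation "E" => EuclideanSpace ℝ (Fin n)

lemma norm_inner_normal_form {e₀ e₁ e₂ : E} (h₀ : ‖e₀‖ = 1) (h₁ : ‖e₁‖ = 1) (h₂ : ‖e₂‖ = 1)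
    (h₀₁ : inner ℝ e₀ e₁ = 0) (h₀₂ : inner ℝ e₀ e₂ = 0) (h₁₂ : inner ℝ e₁ e₂ = 0)
    {a s b w t : ℝ} (hy : a ^ 2 + s ^ 2 = 1) (hz : b ^ 2 + w ^ 2 + t ^ 2 = 1) :
    ‖a • e₀ + s • e₁‖ = 1 ∧ ‖b • e₀ + w • e₁ + t • e₂‖ = 1 ∧
      inner ℝ e₀ (a • e₀ + s • e₁) = a ∧ inner ℝ e₀ (b • e₀ + w • e₁ + t • e₂) = b ∧
      inner ℝ (a • e₀ + s • e₁) (b • e₀ + w • e₁ + t • e₂) = a * b + s * w := by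
  have h₁₀ : inner ℝ e₁ e₀ = 0 := by rw [real_inner_comm, h₀₁]
  have h₂₀ : inner ℝ e₂ e₀ = 0 := by rw [real_inner_comm, h₀₂]
  have h₂₁ : inner ℝ e₂ e₁ = 0 := by rw [real_inner_comm, h₁₂]
  have unit {x : E} (h : inner ℝ x x = 1) : ‖x‖ = 1 := by
    rw [real_inner_self_eq_norm_sq] at h
    exact (pow_eq_one_iff_of_nonneg (norm_nonneg _) two_ne_zero).1 h
  refine ⟨unit ?_, unit ?_, ?_, ?_, ?_⟩ <;>
    simp only [inner_add_left, inner_add_right, real_inner_smul_left, real_inner_smul_right,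
      inner_self_eq_one_of_norm_eq_one, h₀, h₁, h₂, h₀₁, h₀₂, h₁₂, h₁₀, h₂₀, h₂₁]
  · linear_combination hy
  · linear_combination hz
  all_goals ring

lemma exists_normal_form_parameters {x y z : E} (hx : ‖x‖ = 1) (hy : ‖y‖ = 1) (hz : ‖z‖ = 1)
    (hxy : inner ℝ x y ^ 2 ≠ 1) :
    ∃ s w t : ℝ, inner ℝ x y ^ 2 + s ^ 2 = 1 ∧ inner ℝ x z ^ 2 + w ^ 2 + t ^ 2 = 1 ∧
      inner ℝ y z = inner ℝ x y * inner ℝ x z + s * w := by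
  set a := inner ℝ x y with ha
  set b := inner ℝ x z with hb
  have hxx : inner ℝ x x = 1 := by rw [real_inner_self_eq_norm_sq, hx, one_pow]
  have hyy : inner ℝ y y = 1 := by rw [real_inner_self_eq_norm_sq, hy, one_pow]
  have hzz : inner ℝ z z = 1 := by rw [real_inner_self_eq_norm_sq, hz, one_pow]
  have hyx : inner ℝ y x = a := real_inner_comm _ _
  have hzx : inner ℝ z x = b := real_inner_comm _ _
  have hzy : inner ℝ z y = inner ℝ y z := real_inner_comm _ _
  let s := ‖y - a • x‖
  have hs : s ^ 2 = 1 - a ^ 2 := by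
    rw [← real_inner_self_eq_norm_sq]
    simp only [inner_sub_left, inner_sub_right, real_inner_smul_left, real_inner_smul_right,
      hxx, hyy, hyx, ← ha]
    ring
  have hs0 : s ≠ 0 := by
    intro h
    rw [h] at hs
    exact hxy (by linear_combination hs)
  let w := (inner ℝ y z - a * b) / s
  have hsw : s * w = inner ℝ y z - a * b := mul_div_cancel₀ _ hs0
  refine ⟨s, w, ‖z - b • x - (w / s) • (y - a • x)‖, by rw [hs]; ring, ?_, by rw [hsw]; ring⟩
  rw [← real_inner_self_eq_norm_sq]
  simp only [inner_sub_left, inner_sub_right, real_inner_smul_left, real_inner_smul_right,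
      hxx, hyy, hyx, hzz, hzx, hzy, ← ha, ← hb]
  have hk : s * (w / s) = w := mul_div_cancel₀ _ hs0
  generalize w / s = k at *
  have hc : inner ℝ y z = s ^ 2 * k + a * b := by rw [pow_two, mul_assoc, hk, hsw]; ring
  rw [hc, ← hk, mul_pow, hs]
  ring

lemma exists_orthonormal_triple (hn : 4 ≤ n) :
    ∃ e₀ e₁ e₂ : E, ‖e₀‖ = 1 ∧ ‖e₁‖ = 1 ∧ ‖e₂‖ = 1 ∧
      inner ℝ e₀ e₁ = 0 ∧ inner ℝ e₀ e₂ = 0 ∧ inner ℝ e₁ e₂ = 0 := by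
  obtain ⟨e₂, h₂, -⟩ := exists_unit_orthogonal_triple hn 0 0 0
  obtain ⟨e₁, h₁, h₁₂, -⟩ := exists_unit_orthogonal_triple hn e₂ 0 0
  obtain ⟨e₀, h₀, h₀₁, h₀₂, -⟩ := exists_unit_orthogonal_triple hn e₁ e₂ 0
  exact ⟨e₀, e₁, e₂, h₀, h₁, h₂, h₀₁, h₀₂, h₁₂⟩

/-- A polynomial function depending only on the Gram matrix of a triple of unit vectors is a
rational function of the Gram matrix, with denominator a power of `1 - ⟪x, y⟫ ^ 2`. -/
lemma exists_rational_in_gram (hn : 4 ≤ n) (P : MvPolynomial (Fin 3 × Fin n) ℝ)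
    (hP : ∀ x y z x' y' z' : E, ‖x‖ = 1 → ‖y‖ = 1 → ‖z‖ = 1 → ‖x'‖ = 1 → ‖y'‖ = 1 → ‖z'‖ = 1 →
      inner ℝ x y = inner ℝ x' y' → inner ℝ x z = inner ℝ x' z' → inner ℝ y z = inner ℝ y' z' →
      evalTriple P x y z = evalTriple P x' y' z') :
    ∃ (m : ℕ) (N : MvPolynomial (Fin 3) ℝ), ∀ x y z : E, ‖x‖ = 1 → ‖y‖ = 1 → ‖z‖ = 1 →
      inner ℝ x y ^ 2 ≠ 1 → (1 - inner ℝ x y ^ 2) ^ m * evalTriple P x y z =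
        eval ![inner ℝ x y, inner ℝ x z, inner ℝ y z] N := by
  obtain ⟨e₀, e₁, e₂, h₀, h₁, h₂, h₀₁, h₀₂, h₁₂⟩ := exists_orthonormal_triple hn
  obtain ⟨m, N₀, N₁, N₂, N₃, hN⟩ := exists_normal_form_expansion e₀ e₁ e₂ P
  refine ⟨m, N₀, fun x y z hx hy hz hxy => ?_⟩
  obtain ⟨s, w, t, hs, hw, hc⟩ := exists_normal_form_parameters hx hy hz hxy
  have expand (s' w' t' : ℝ) (hs' : inner ℝ x y ^ 2 + s' ^ 2 = 1)
      (hw' : inner ℝ x z ^ 2 + w' ^ 2 + t' ^ 2 = 1) (hsw : s' * w' = s * w) :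
      (1 - inner ℝ x y ^ 2) ^ m * evalTriple P x y z =
        eval ![inner ℝ x y, inner ℝ x z, inner ℝ y z] N₀ +
        eval ![inner ℝ x y, inner ℝ x z, inner ℝ y z] N₁ * s' +
        eval ![inner ℝ x y, inner ℝ x z, inner ℝ y z] N₂ * t' +
        eval ![inner ℝ x y, inner ℝ x z, inner ℝ y z] N₃ * (s' * t') := by
    obtain ⟨ny, nz, ixy, ixz, iyz⟩ := norm_inner_normal_form h₀ h₁ h₂ h₀₁ h₀₂ h₁₂ hs' hw'
    have h := hN _ _ _ _ _ hs' hw'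
    rw [hsw, ← hc] at h
    rw [← h, hP x y z _ _ _ hx hy hz h₀ ny nz ixy.symm ixz.symm (by rw [iyz, hsw, hc]), evalTriple]
    congr 3
    funext ⟨j, i⟩
    fin_cases j <;> simp
  linear_combination (expand s w t hs hw rfl + expand s w (-t) hs (by rwa [neg_sq]) rfl +
    expand (-s) (-w) t (by rwa [neg_sq]) (by rwa [neg_sq]) (neg_mul_neg s w) +
    expand (-s) (-w) (-t) (by rwa [neg_sq]) (by rwa [neg_sq, neg_sq]) (neg_mul_neg s w)) / 4

lemma exists_unit_triple_of_small_gram (hn : 4 ≤ n) {a b c : ℝ} (ha : |a| < 1 / 4)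
    (hb : |b| < 1 / 4) (hc : |c| < 1 / 4) :
    ∃ x y z : E, ‖x‖ = 1 ∧ ‖y‖ = 1 ∧ ‖z‖ = 1 ∧
      inner ℝ x y = a ∧ inner ℝ x z = b ∧ inner ℝ y z = c := by
  obtain ⟨e₀, e₁, e₂, h₀, h₁, h₂, h₀₁, h₀₂, h₁₂⟩ := exists_orthonormal_triple hn
  have hab : |a * b| ≤ 1 / 4 * (1 / 4) := by
    rw [abs_mul]
    gcongr
  have ha2 : a ^ 2 ≤ (1 / 4) ^ 2 := sq_le_sq' (abs_lt.1 ha).1.le (abs_lt.1 ha).2.le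
  have hb2 : b ^ 2 ≤ (1 / 4) ^ 2 := sq_le_sq' (abs_lt.1 hb).1.le (abs_lt.1 hb).2.le
  rw [abs_lt] at hc
  rw [abs_le] at hab
  have hd2 : (c - a * b) ^ 2 ≤ (5 / 16) ^ 2 := sq_le_sq' (by linarith) (by linarith)
  have hs : √(1 - a ^ 2) ^ 2 = 1 - a ^ 2 := Real.sq_sqrt (by linarith)
  have hs0 : √(1 - a ^ 2) ≠ 0 := by
    rw [Real.sqrt_ne_zero (by linarith)]
    linarith
  have hw : ((c - a * b) / √(1 - a ^ 2)) ^ 2 ≤ 1 / 2 := by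
    rw [div_pow, hs, div_le_iff₀ (by linarith)]
    linarith
  have ht := Real.sq_sqrt (x := 1 - b ^ 2 - ((c - a * b) / √(1 - a ^ 2)) ^ 2) (by linarith)
  obtain ⟨ny, nz, ixy, ixz, iyz⟩ := norm_inner_normal_form h₀ h₁ h₂ h₀₁ h₀₂ h₁₂
    (a := a) (s := √(1 - a ^ 2)) (b := b) (w := (c - a * b) / √(1 - a ^ 2))
    (by rw [hs]; ring) (by rw [ht]; ring)
  refine ⟨_, _, _, h₀, ny, nz, ixy, ixz, ?_⟩
  rw [iyz, mul_div_cancel₀ _ hs0]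
  ring

end NormalForm

section Divisibility

lemma prime_one_sub_C_mul_X {ε : ℝ} (hε : ε ≠ 0) :
    Prime (1 - C ε * X 0 : MvPolynomial (Fin 3) ℝ) := by
  rw [← UniqueFactorizationMonoid.irreducible_iff_prime]
  have h := irreducible_mul_X_add (C (-ε) : MvPolynomial (Fin 3) ℝ) 1 0 (by simpa using hε)
    (by simp) (by simp) isRelPrime_one_right
  rwa [map_neg, neg_mul, neg_add_eq_sub] at h

lemma one_sub_sq_pow_dvd {m k : ℕ} {N M : MvPolynomial (Fin 3) ℝ}
    (h : N * (1 - X 1 ^ 2) ^ k = M * (1 - X 0 ^ 2) ^ m) : (1 - X 0 ^ 2) ^ m ∣ N := by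
  have fac : (1 - X 0 ^ 2 : MvPolynomial (Fin 3) ℝ) =
      (1 - C 1 * X 0) * (1 - C (-1) * X 0) := by
    simp only [map_neg, map_one]
    ring
  have dvd (ε : ℝ) (hε : ε ^ 2 = 1) (hd : (1 - C ε * X 0 : MvPolynomial (Fin 3) ℝ) ∣ 1 - X 0 ^ 2) :
      (1 - C ε * X 0 : MvPolynomial (Fin 3) ℝ) ^ m ∣ N := by
    have hp := prime_one_sub_C_mul_X (ε := ε) (by rintro rfl; simp at hε)
    refine hp.pow_dvd_of_dvd_mul_right m (b := (1 - X 1 ^ 2) ^ k) (fun hdiv => ?_) ?_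
    · obtain ⟨Q, hQ⟩ := hp.dvd_of_dvd_pow hdiv
      have := congrArg (eval ![ε, 0, 0]) hQ
      simp [← pow_two, hε] at this
    · rw [h]
      exact (pow_dvd_pow_of_dvd hd m).mul_left M
  rw [fac, mul_pow]
  refine IsCoprime.mul_dvd (IsCoprime.pow ⟨C (1 / 2), C (1 / 2), ?_⟩)
    (dvd 1 (by norm_num) (fac ▸ dvd_mul_right _ _)) (dvd (-1) (by norm_num) (fac ▸ dvd_mul_left _ _))
  have : (C (1 / 2) * 2 : MvPolynomial (Fin 3) ℝ) = 1 := by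
    rw [← map_ofNat (C (σ := Fin 3) (R := ℝ)) 2, ← map_mul]
    norm_num
  simp only [map_neg, map_one]
  linear_combination this

end Divisibility

section Generation

variable {n : ℕ}

local notation "E" => EuclideanSpace ℝ (Fin n)

lemma continuous_evalTriple_s4 (P : MvPolynomial (Fin 3 × Fin n) ℝ) {x y z : ℝ → E}
    (hx : Continuous x) (hy : Continuous y) (hz : Continuous z) :
    Continuous fun θ => evalTriple P (x θ) (y θ) (z θ) := by
  refine (MvPolynomial.continuous_eval P).comp (continuous_pi fun ⟨j, i⟩ => ?_)
  fin_cases j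
  · exact (EuclideanSpace.proj (𝕜 := ℝ) i).continuous.comp hx
  · exact (EuclideanSpace.proj (𝕜 := ℝ) i).continuous.comp hy
  · exact (EuclideanSpace.proj (𝕜 := ℝ) i).continuous.comp hz

lemma continuous_eval_gram (Q : MvPolynomial (Fin 3) ℝ) {x y z : ℝ → E}
    (hx : Continuous x) (hy : Continuous y) (hz : Continuous z) :
    Continuous fun θ =>
      eval ![inner ℝ (x θ) (y θ), inner ℝ (x θ) (z θ), inner ℝ (y θ) (z θ)] Q := by
  refine (MvPolynomial.continuous_eval Q).comp (continuous_pi fun j => ?_)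
  fin_cases j
  · exact hx.inner hy
  · exact hx.inner hz
  · exact hy.inner hz

/-- A polynomial identity in the Gram matrix extends to triples with `⟪x, y⟫ ^ 2 = 1`. -/
lemma eq_eval_gram_of_generic (hn : 4 ≤ n) (P : MvPolynomial (Fin 3 × Fin n) ℝ)
    (Q : MvPolynomial (Fin 3) ℝ)
    (h : ∀ x y z : E, ‖x‖ = 1 → ‖y‖ = 1 → ‖z‖ = 1 → inner ℝ x y ^ 2 ≠ 1 →
      evalTriple P x y z = eval ![inner ℝ x y, inner ℝ x z, inner ℝ y z] Q)
    {x y z : E} (hx : ‖x‖ = 1) (hy : ‖y‖ = 1) (hz : ‖z‖ = 1) :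
    evalTriple P x y z = eval ![inner ℝ x y, inner ℝ x z, inner ℝ y z] Q := by
  by_cases hxy : inner ℝ x y ^ 2 = 1
  swap
  · exact h x y z hx hy hz hxy
  obtain ⟨v, hv, hvx, hvy, -⟩ := exists_unit_orthogonal_triple hn x y 0
  let p : ℝ → E := fun θ => Real.cos θ • y + Real.sin θ • v
  have hp : Continuous p := by fun_prop
  have heq : Set.EqOn (fun θ => evalTriple P x (p θ) z)
      (fun θ => eval ![inner ℝ x (p θ), inner ℝ x z, inner ℝ (p θ) z] Q) (Set.Ioo 0 1) := by
    intro θ hθ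
    have hyv : inner ℝ y v = 0 := by rw [real_inner_comm, hvy]
    have hxv : inner ℝ x v = 0 := by rw [real_inner_comm, hvx]
    have hsin : 0 < Real.sin θ :=
      Real.sin_pos_of_pos_of_lt_pi hθ.1 (hθ.2.trans (by linarith [Real.pi_gt_three]))
    refine h x (p θ) z hx ?_ hz ?_
    · rw [← pow_eq_one_iff_of_nonneg (norm_nonneg _) two_ne_zero, norm_add_sq_real, norm_smul,
        norm_smul, hy, hv, real_inner_smul_left, real_inner_smul_right, hyv]
      simp
    · simp only [p, inner_add_right, real_inner_smul_right, hxv, mul_zero, add_zero, mul_pow, hxy,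
        mul_one]
      nlinarith [Real.sin_sq_add_cos_sq θ]
  have := heq.closure (continuous_evalTriple_s4 P continuous_const hp continuous_const)
    (continuous_eval_gram Q continuous_const hp continuous_const)
    (x := 0) (by rw [closure_Ioo zero_ne_one]; simp)
  simpa [p] using this

/-- A polynomial function depending only on the Gram matrix of a triple of unit vectors is
a polynomial in the entries of the Gram matrix. -/
lemma exists_polynomial_in_gram (hn : 4 ≤ n) (P : MvPolynomial (Fin 3 × Fin n) ℝ)
    (hP : ∀ x y z x' y' z' : E, ‖x‖ = 1 → ‖y‖ = 1 → ‖z‖ = 1 → ‖x'‖ = 1 → ‖y'‖ = 1 → ‖z'‖ = 1 →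
      inner ℝ x y = inner ℝ x' y' → inner ℝ x z = inner ℝ x' z' → inner ℝ y z = inner ℝ y' z' →
      evalTriple P x y z = evalTriple P x' y' z') :
    ∃ Q : MvPolynomial (Fin 3) ℝ, ∀ x y z : E, ‖x‖ = 1 → ‖y‖ = 1 → ‖z‖ = 1 →
      evalTriple P x y z = eval ![inner ℝ x y, inner ℝ x z, inner ℝ y z] Q := by
  obtain ⟨m, N, hN⟩ := exists_rational_in_gram hn P hP
  let P' := rename (Prod.map (Equiv.swap 1 2) id) P
  have hP' (x y z : E) : evalTriple P' x z y = evalTriple P x y z := by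
    simp only [evalTriple, P', eval_rename]
    congr 2
    funext ⟨j, i⟩
    fin_cases j <;> rfl
  obtain ⟨k, M, hM⟩ := exists_rational_in_gram hn P'
    fun x y z x' y' z' hx hy hz hx' hy' hz' hxy hxz hyz => by
      rw [hP', hP']
      exact hP _ _ _ _ _ _ hx hz hy hx' hz' hy' hxz hxy
        (by rw [real_inner_comm, hyz, real_inner_comm])
  have hNM : N * (1 - X 1 ^ 2) ^ k = rename (Equiv.swap 0 1) M * (1 - X 0 ^ 2) ^ m := by
    refine funext_set (fun _ => Set.Ioo (-(1 / 4)) (1 / 4))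
      (fun _ => Set.Ioo_infinite (by norm_num)) fun g hg => ?_
    have hg' (i : Fin 3) : |g i| < 1 / 4 := abs_lt.2 (hg i trivial)
    have hg2 (i : Fin 3) : g i ^ 2 ≠ 1 := by
      have := hg i trivial
      nlinarith [this.1, this.2]
    obtain ⟨x, y, z, hx, hy, hz, hxy, hxz, hyz⟩ :=
      exists_unit_triple_of_small_gram hn (hg' 0) (hg' 1) (hg' 2)
    have e₁ := hN x y z hx hy hz (by rw [hxy]; exact hg2 0)
    have e₂ := hM x z y hx hz hy (by rw [hxz]; exact hg2 1)
    rw [hP', real_inner_comm y z] at e₂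
    rw [hxy, hxz, hyz] at e₁ e₂
    have hv : ![g 0, g 1, g 2] = g := by
      funext i
      fin_cases i <;> rfl
    have hv' : ![g 1, g 0, g 2] = g ∘ Equiv.swap 0 1 := by
      funext i
      fin_cases i <;> rfl
    rw [hv] at e₁
    rw [hv'] at e₂
    simp only [map_mul, map_pow, map_sub, map_one, eval_X, eval_rename, ← e₁, ← e₂]
    ring
  obtain ⟨Q, rfl⟩ := one_sub_sq_pow_dvd hNM
  refine ⟨Q, fun x y z hx hy hz => eq_eval_gram_of_generic hn P Q ?_ hx hy hz⟩
  intro x y z hx hy hz hxy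
  have := hN x y z hx hy hz hxy
  simp only [map_mul, map_pow, map_sub, map_one, eval_X, Matrix.cons_val_zero] at this
  exact mul_left_cancel₀ (pow_ne_zero m (sub_ne_zero.2 hxy.symm)) this

lemma inner_eq_one_sub_dist_sq_div_two {x y : E} (hx : ‖x‖ = 1) (hy : ‖y‖ = 1) :
    inner ℝ x y = 1 - dist x y ^ 2 / 2 := by
  rw [dist_eq_norm, @norm_sub_sq_real, hx, hy]
  ring

end Generation

/-- for `n ≥ 4`, every `SO(n)`-invariant polynomial function on `S×S×S` is a
polynomial in `|y−z|²`, `|z−x|²`, `|x−y|²`.  Here `SO(n)` is realized as the group of linear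
isometries of `ℝⁿ` of determinant `1`. -/
theorem invariant_polynomials_generated_by_distances (n : ℕ) (hn : 4 ≤ n)
    (P : MvPolynomial (Fin 3 × Fin n) ℝ)
    (hP : ∀ k : EuclideanSpace ℝ (Fin n) ≃ₗᵢ[ℝ] EuclideanSpace ℝ (Fin n),
      k.toLinearEquiv.det = 1 →
      ∀ x y z : EuclideanSpace ℝ (Fin n), ‖x‖ = 1 → ‖y‖ = 1 → ‖z‖ = 1 →
        evalTriple P (k x) (k y) (k z) = evalTriple P x y z) :
    ∃ q : MvPolynomial (Fin 3) ℝ,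
      ∀ x y z : EuclideanSpace ℝ (Fin n), ‖x‖ = 1 → ‖y‖ = 1 → ‖z‖ = 1 →
        evalTriple P x y z =
          MvPolynomial.eval ![dist y z ^ 2, dist z x ^ 2, dist x y ^ 2] q := by
  obtain ⟨Q, hQ⟩ := exists_polynomial_in_gram hn P
    fun x y z x' y' z' hx hy hz hx' hy' hz' => eq_of_gram_eq hn hP hx hy hz hx' hy' hz'
  refine ⟨bind₁ ![1 - C (1 / 2) * X 2, 1 - C (1 / 2) * X 1, 1 - C (1 / 2) * X 0] Q,
    fun x y z hx hy hz => ?_⟩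
  rw [hQ x y z hx hy hz, inner_eq_one_sub_dist_sq_div_two hx hy,
    inner_eq_one_sub_dist_sq_div_two hx hz, inner_eq_one_sub_dist_sq_div_two hy hz, dist_comm x z]
  refine Eq.trans ?_ (eval₂Hom_bind₁ _ _ _ _).symm
  change eval _ Q = eval _ Q
  congr 2
  funext i
  fin_cases i <;> simp <;> ring
end

section
/- Let n ≥ 4 and ρ = (n−1)/2. Let α = (α₁,α₂,α₃) ∈ ℂ³ with α₁ = −(n−1)−2k₁ and α₂ = −(n−1)−2k₂ for some k₁,k₂ ∈ ℕ. Then I_α(a₁,a₂,a₃) = 0 for all (a₁,a₂,a₃) ∈ ℕ³. -/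
open Polynomial

/-- `ρ = (n-1)/2` as a complex number. -/
noncomputable def rhoC (n : ℕ) : ℂ := ((n : ℂ) - 1) / 2

/-- The Pochhammer symbol `(z)_m = z(z+1)⋯(z+m-1)`. -/
noncomputable def poch (z : ℂ) (m : ℕ) : ℂ := (ascPochhammer ℂ m).eval z

/-- `I_α(a₁,a₂,a₃)`, the value of the normalized trilinear form `K̃_α` on the invariant
polynomial `p_{a₁,a₂,a₃}(x,y,z) = |x−y|^{2a₃}|y−z|^{2a₁}|z−x|^{2a₂}`. -/
noncomputable def Ival (n : ℕ) (α₁ α₂ α₃ : ℂ) (a₁ a₂ a₃ : ℕ) : ℂ :=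
  (((Real.pi / 2) ^ (3 * ((n : ℝ) - 1) / 2) : ℝ) : ℂ) *
    (2 : ℂ) ^ (α₁ + α₂ + α₃ + 2 * ((a₁ : ℂ) + (a₂ : ℂ) + (a₃ : ℂ))) *
    poch ((α₁ + α₂ + α₃) / 2 + 2 * rhoC n) (a₁ + a₂ + a₃) *
    poch (α₁ / 2 + rhoC n) a₁ * poch (α₂ / 2 + rhoC n) a₂ * poch (α₃ / 2 + rhoC n) a₃ /
    (Complex.Gamma ((α₁ + α₂) / 2 + 2 * rhoC n + (a₁ : ℂ) + (a₂ : ℂ)) *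
      Complex.Gamma ((α₂ + α₃) / 2 + 2 * rhoC n + (a₂ : ℂ) + (a₃ : ℂ)) *
      Complex.Gamma ((α₃ + α₁) / 2 + 2 * rhoC n + (a₃ : ℂ) + (a₁ : ℂ)))

/-- The zero set `Z` of the normalized family, in the geometric parameter. -/
def memZ (n : ℕ) (α₁ α₂ α₃ : ℂ) : Prop :=
  (∃ i j : Fin 3, i ≠ j ∧
    (∃ k : ℕ, ![α₁, α₂, α₃] i = -((n : ℂ) - 1) - 2 * k) ∧
    (∃ k : ℕ, ![α₁, α₂, α₃] j = -((n : ℂ) - 1) - 2 * k)) ∨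
  ((∃ k : ℕ, α₁ + α₂ + α₃ = -2 * ((n : ℂ) - 1) - 2 * k) ∧
    (∃ i : Fin 3, ∃ l : ℕ, ![α₁, α₂, α₃] i = 2 * (l : ℂ)))

/-- `(-k)_a` vanishes once `a` exceeds `k`. -/
theorem poch_neg_natCast_of_lt {k a : ℕ} (h : k < a) : poch (-(k : ℂ)) a = 0 :=
  ascPochhammer_eval_neg_coe_nat_of_lt h

/-- the first vanishing situation. -/
theorem Ival_eq_zero_of_typeI (n : ℕ) (hn : 4 ≤ n) (α₁ α₂ α₃ : ℂ) (k₁ k₂ : ℕ)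
    (h₁ : α₁ = -((n : ℂ) - 1) - 2 * k₁) (h₂ : α₂ = -((n : ℂ) - 1) - 2 * k₂) :
    ∀ a₁ a₂ a₃ : ℕ, Ival n α₁ α₂ α₃ a₁ a₂ a₃ = 0 := by
  intro a₁ a₂ a₃
  have e₁ : α₁ / 2 + rhoC n = -(k₁ : ℂ) := by rw [h₁, rhoC]; ring
  have e₂ : α₂ / 2 + rhoC n = -(k₂ : ℂ) := by rw [h₂, rhoC]; ring
  rcases lt_or_ge k₁ a₁ with l₁ | l₁
  · simp [Ival, e₁, poch_neg_natCast_of_lt l₁]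
  rcases lt_or_ge k₂ a₂ with l₂ | l₂
  · simp [Ival, e₂, poch_neg_natCast_of_lt l₂]
  have e : (α₁ + α₂) / 2 + 2 * rhoC n + (a₁ : ℂ) + (a₂ : ℂ) =
      -(((k₁ - a₁) + (k₂ - a₂) : ℕ) : ℂ) := by
    push_cast [Nat.cast_sub l₁, Nat.cast_sub l₂]
    linear_combination e₁ + e₂
  rw [Ival, e, Complex.Gamma_neg_nat_eq_zero, zero_mul, zero_mul, div_zero]
end

section
/- Let n ≥ 4 and ρ = (n−1)/2. Let α = (α₁,α₂,α₃) ∈ ℂ³ with α₁+α₂+α₃ = −2(n−1)−2k and α₃ = 2l₃ for some k, l₃ ∈ ℕ. Then I_α(a₁,a₂,a₃) = 0 for all (a₁,a₂,a₃) ∈ ℕ³. -/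
open Polynomial

/-- the second vanishing situation. -/
theorem Ival_eq_zero_of_typeII (n : ℕ) (hn : 4 ≤ n) (α₁ α₂ α₃ : ℂ) (k l₃ : ℕ)
    (hsum : α₁ + α₂ + α₃ = -2 * ((n : ℂ) - 1) - 2 * k) (h₃ : α₃ = 2 * (l₃ : ℂ)) :
    ∀ a₁ a₂ a₃ : ℕ, Ival n α₁ α₂ α₃ a₁ a₂ a₃ = 0 := by
  intro a₁ a₂ a₃
  have hpole : (α₁ + α₂ + α₃) / 2 + 2 * rhoC n = -(k : ℂ) := by
    rw [hsum, rhoC]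
    ring
  rcases lt_or_ge k (a₁ + a₂ + a₃) with hk | hk
  · have hpoch : poch ((α₁ + α₂ + α₃) / 2 + 2 * rhoC n) (a₁ + a₂ + a₃) = 0 := by
      rw [hpole, poch]
      exact ascPochhammer_eval_neg_coe_nat_of_lt hk
    simp [Ival, hpoch]
  · have hGamma : Complex.Gamma ((α₁ + α₂) / 2 + 2 * rhoC n + (a₁ : ℂ) + (a₂ : ℂ)) = 0 := by
      rw [Complex.Gamma_eq_zero_iff]
      refine ⟨k + l₃ - (a₁ + a₂), ?_⟩
      rw [Nat.cast_sub (by omega)]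
      push_cast
      linear_combination hpole - h₃ / 2
    simp [Ival, hGamma]
end

section
/- Let n ≥ 4 and ρ = (n−1)/2, and let α = (α₁,α₂,α₃) ∈ ℂ³. Then I_α(a₁,a₂,a₃) = 0 for all (a₁,a₂,a₃) ∈ ℕ³ if and only if α ∈ Z, i.e. if and only if (up to a permutation of the indices) either α₁ ∈ −(n−1)−2ℕ and α₂ ∈ −(n−1)−2ℕ, or α₁+α₂+α₃ ∈ −2(n−1)−2ℕ and α₃ ∈ 2ℕ. -/
open Polynomial

lemma poch_eq_zero_iff (z : ℂ) (m : ℕ) : poch z m = 0 ↔ ∃ j < m, z = -(j : ℂ) := by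
  rw [poch, ascPochhammer_eval_eq_zero_iff]
  exact exists_congr fun j => and_congr_right fun _ => ⟨fun h => by rw [h, neg_neg], fun h => by rw [h, neg_neg]⟩

lemma exists_forall_add_natCast_ne_neg (z : ℂ) :
    ∃ N : ℕ, ∀ m : ℕ, N ≤ m → ∀ j : ℕ, z + m ≠ -(j : ℂ) := by
  obtain ⟨N, hN⟩ := exists_nat_gt (-z.re)
  refine ⟨N, fun m hm j h => ?_⟩
  have hre := congrArg Complex.re h
  simp only [Complex.add_re, Complex.natCast_re, Complex.neg_re] at hre
  have hm' : (N : ℝ) ≤ m := by exact_mod_cast hm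
  have hj : (0 : ℝ) ≤ j := j.cast_nonneg
  linarith

/-- In terms of `xᵢ = αᵢ/2 + ρ`, the conditions under which `I_α` does not vanish. -/
def IsNonvanishing (r x₁ x₂ x₃ : ℂ) (a₁ a₂ a₃ : ℕ) : Prop :=
  (∀ j < a₁ + a₂ + a₃, x₁ + x₂ + x₃ - r ≠ -(j : ℂ)) ∧
  (∀ j < a₁, x₁ ≠ -(j : ℂ)) ∧ (∀ j < a₂, x₂ ≠ -(j : ℂ)) ∧ (∀ j < a₃, x₃ ≠ -(j : ℂ)) ∧
  (∀ j : ℕ, x₁ + x₂ + ((a₁ + a₂ : ℕ) : ℂ) ≠ -(j : ℂ)) ∧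
  (∀ j : ℕ, x₂ + x₃ + ((a₂ + a₃ : ℕ) : ℂ) ≠ -(j : ℂ)) ∧
  (∀ j : ℕ, x₃ + x₁ + ((a₃ + a₁ : ℕ) : ℂ) ≠ -(j : ℂ))

lemma Ival_ne_zero_iff (n : ℕ) (α₁ α₂ α₃ : ℂ) (a₁ a₂ a₃ : ℕ) :
    Ival n α₁ α₂ α₃ a₁ a₂ a₃ ≠ 0 ↔
      IsNonvanishing (rhoC n) (α₁ / 2 + rhoC n) (α₂ / 2 + rhoC n) (α₃ / 2 + rhoC n) a₁ a₂ a₃ := by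
  have hpi : (((Real.pi / 2) ^ (3 * ((n : ℝ) - 1) / 2) : ℝ) : ℂ) ≠ 0 := by
    exact_mod_cast (Real.rpow_pos_of_pos (by positivity) _).ne'
  have htwo : (2 : ℂ) ^ (α₁ + α₂ + α₃ + 2 * ((a₁ : ℂ) + (a₂ : ℂ) + (a₃ : ℂ))) ≠ 0 := by
    simp [Complex.cpow_eq_zero_iff]
  have hS : (α₁ + α₂ + α₃) / 2 + 2 * rhoC n =
      (α₁ / 2 + rhoC n) + (α₂ / 2 + rhoC n) + (α₃ / 2 + rhoC n) - rhoC n := by ring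
  have hpair (α β : ℂ) (a b : ℕ) : (α + β) / 2 + 2 * rhoC n + (a : ℂ) + (b : ℂ) =
      (α / 2 + rhoC n) + (β / 2 + rhoC n) + ((a + b : ℕ) : ℂ) := by push_cast; ring
  simp only [Ival, IsNonvanishing, ne_eq, div_eq_zero_iff, mul_eq_zero, hpi, htwo,
    poch_eq_zero_iff, Complex.Gamma_eq_zero_iff, hS, hpair, not_or, not_exists, not_and,
    not_false_eq_true, true_and, and_assoc]

lemma not_isNonvanishing_of_neg_natCast {r x₁ x₂ x₃ : ℂ} {k₁ k₂ : ℕ} (h₁ : x₁ = -(k₁ : ℂ))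
    (h₂ : x₂ = -(k₂ : ℂ)) (a₁ a₂ a₃ : ℕ) : ¬ IsNonvanishing r x₁ x₂ x₃ a₁ a₂ a₃ := by
  rintro ⟨-, ha₁, ha₂, -, h, -, -⟩
  have hle₁ : a₁ ≤ k₁ := not_lt.1 fun hlt => ha₁ k₁ hlt h₁
  have hle₂ : a₂ ≤ k₂ := not_lt.1 fun hlt => ha₂ k₂ hlt h₂
  apply h (k₁ + k₂ - (a₁ + a₂))
  rw [Nat.cast_sub (by omega), h₁, h₂]
  push_cast
  ring

lemma not_isNonvanishing_of_sum {r x₁ x₂ x₃ : ℂ} {k l : ℕ} (hS : x₁ + x₂ + x₃ - r = -(k : ℂ))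
    (h₃ : x₃ = r + l) (a₁ a₂ a₃ : ℕ) : ¬ IsNonvanishing r x₁ x₂ x₃ a₁ a₂ a₃ := by
  rintro ⟨ha, -, -, -, h, -, -⟩
  have hle : a₁ + a₂ + a₃ ≤ k := not_lt.1 fun hlt => ha k hlt hS
  apply h (k + l - (a₁ + a₂))
  rw [Nat.cast_sub (by omega)]
  push_cast
  linear_combination hS - h₃

lemma IsNonvanishing.rotate {r x₁ x₂ x₃ : ℂ} {a₁ a₂ a₃ : ℕ}
    (h : IsNonvanishing r x₁ x₂ x₃ a₁ a₂ a₃) : IsNonvanishing r x₂ x₃ x₁ a₂ a₃ a₁ := by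
  obtain ⟨hS, h₁, h₂, h₃, h₁₂, h₂₃, h₃₁⟩ := h
  refine ⟨?_, h₂, h₃, h₁, h₂₃, h₃₁, h₁₂⟩
  rwa [show a₂ + a₃ + a₁ = a₁ + a₂ + a₃ by ring, show x₂ + x₃ + x₁ = x₁ + x₂ + x₃ by ring]

lemma exists_isNonvanishing_of_sum_ne {r x₁ x₂ x₃ : ℂ}
    (hS : ∀ k : ℕ, x₁ + x₂ + x₃ - r ≠ -(k : ℂ))
    (h₁₂ : ¬ ((∃ k : ℕ, x₁ = -(k : ℂ)) ∧ ∃ k : ℕ, x₂ = -(k : ℂ)))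
    (h₂₃ : ¬ ((∃ k : ℕ, x₂ = -(k : ℂ)) ∧ ∃ k : ℕ, x₃ = -(k : ℂ)))
    (h₃₁ : ¬ ((∃ k : ℕ, x₃ = -(k : ℂ)) ∧ ∃ k : ℕ, x₁ = -(k : ℂ))) :
    ∃ a₁ a₂ a₃ : ℕ, IsNonvanishing r x₁ x₂ x₃ a₁ a₂ a₃ := by
  obtain ⟨N₁, hN₁⟩ := exists_forall_add_natCast_ne_neg (x₁ + x₂)
  obtain ⟨N₂, hN₂⟩ := exists_forall_add_natCast_ne_neg (x₂ + x₃)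
  obtain ⟨N₃, hN₃⟩ := exists_forall_add_natCast_ne_neg (x₃ + x₁)
  have key (x : ℂ) : ∃ a : ℕ, (∀ j < a, x ≠ -(j : ℂ)) ∧
      ((∃ k : ℕ, x = -(k : ℂ)) ∨ N₁ + N₂ + N₃ ≤ a) := by
    by_cases h : ∃ k : ℕ, x = -(k : ℂ)
    · exact ⟨0, by simp, Or.inl h⟩
    · exact ⟨N₁ + N₂ + N₃, fun j _ hj => h ⟨j, hj⟩, Or.inr le_rfl⟩
  obtain ⟨a₁, ha₁, hx₁⟩ := key x₁
  obtain ⟨a₂, ha₂, hx₂⟩ := key x₂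
  obtain ⟨a₃, ha₃, hx₃⟩ := key x₃
  refine ⟨a₁, a₂, a₃, fun j _ => hS j, ha₁, ha₂, ha₃, hN₁ _ ?_, hN₂ _ ?_, hN₃ _ ?_⟩
  · by_cases h : ∃ k : ℕ, x₁ = -(k : ℂ)
    · have := hx₂.resolve_left fun h' => h₁₂ ⟨h, h'⟩
      omega
    · have := hx₁.resolve_left h
      omega
  · by_cases h : ∃ k : ℕ, x₂ = -(k : ℂ)
    · have := hx₃.resolve_left fun h' => h₂₃ ⟨h, h'⟩
      omega
    · have := hx₂.resolve_left h
      omega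
  · by_cases h : ∃ k : ℕ, x₃ = -(k : ℂ)
    · have := hx₁.resolve_left fun h' => h₃₁ ⟨h, h'⟩
      omega
    · have := hx₃.resolve_left h
      omega

/-- The exponents `a` allowed at a parameter `x` when `x₁ + x₂ + x₃ - r = -(a₁ + a₂ + a₃)`. -/
def IsAdmissible (r x : ℂ) (a : ℕ) : Prop :=
  (∀ j < a, x ≠ -(j : ℂ)) ∧ ∀ j : ℕ, x + a ≠ r + j

lemma isAdmissible_zero {r x : ℂ} (hx : ∀ l : ℕ, x ≠ r + l) : IsAdmissible r x 0 :=
  ⟨by simp, by simpa using hx⟩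

lemma IsAdmissible.isNonvanishing {r x₁ x₂ x₃ : ℂ} {a₁ a₂ a₃ : ℕ}
    (hS : x₁ + x₂ + x₃ - r = -((a₁ + a₂ + a₃ : ℕ) : ℂ)) (h₁ : IsAdmissible r x₁ a₁)
    (h₂ : IsAdmissible r x₂ a₂) (h₃ : IsAdmissible r x₃ a₃) :
    IsNonvanishing r x₁ x₂ x₃ a₁ a₂ a₃ := by
  refine ⟨fun j hj h => ?_, h₁.1, h₂.1, h₃.1, fun j h => h₃.2 j ?_, fun j h => h₁.2 j ?_,
    fun j h => h₂.2 j ?_⟩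
  · rw [hS, neg_inj, Nat.cast_inj] at h
    omega
  all_goals
    push_cast at hS h
    linear_combination hS - h

lemma isAdmissible_cases {r x : ℂ} {N : ℕ} (hr : 2 * r = N) (hN : 0 < N)
    (hx : ∀ l : ℕ, x ≠ r + l) :
    (∀ a, IsAdmissible r x a) ∨
      ∃ B : ℕ, (∀ a ≤ B, IsAdmissible r x a) ∧ (x = -(B : ℂ) ∨ x = r - ((B + 1 : ℕ) : ℂ)) := by
  by_cases h₁ : ∃ k : ℕ, x = -(k : ℂ)
  · obtain ⟨k, rfl⟩ := h₁
    refine Or.inr ⟨k, fun a ha => ⟨fun j hj h => ?_, fun j h => ?_⟩, Or.inl rfl⟩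
    · rw [neg_inj, Nat.cast_inj] at h
      omega
    · have h' : ((2 * a : ℕ) : ℂ) = ((2 * k + N + 2 * j : ℕ) : ℂ) := by
        push_cast
        linear_combination 2 * h + hr
      have := Nat.cast_injective h'
      omega
  by_cases h₂ : ∃ p : ℕ, x = r - (p : ℂ)
  · obtain ⟨p, rfl⟩ := h₂
    obtain rfl | ⟨B, rfl⟩ : p = 0 ∨ ∃ B, p = B + 1 := by cases p <;> simp
    · exact absurd (by simp) (hx 0)
    refine Or.inr ⟨B, fun a ha => ⟨fun j _ h => h₁ ⟨j, h⟩, fun j h => ?_⟩, Or.inr rfl⟩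
    have h' : ((a : ℕ) : ℂ) = ((B + 1 + j : ℕ) : ℂ) := by
      push_cast at h ⊢
      linear_combination h
    have := Nat.cast_injective h'
    omega
  · refine Or.inl fun a => ⟨fun j _ h => h₁ ⟨j, h⟩, fun j h => ?_⟩
    obtain hja | hja := le_total j a
    · refine h₂ ⟨a - j, ?_⟩
      rw [Nat.cast_sub hja]
      linear_combination h
    · refine hx (j - a) ?_
      rw [Nat.cast_sub hja]
      linear_combination h

lemma exists_le_add_add_eq {B₁ B₂ B₃ k : ℕ} (h : k ≤ B₁ + B₂ + B₃) :
    ∃ a₁ ≤ B₁, ∃ a₂ ≤ B₂, ∃ a₃ ≤ B₃, a₁ + a₂ + a₃ = k :=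
  ⟨min k B₁, by omega, min (k - B₁) B₂, by omega, k - B₁ - B₂, by omega, by omega⟩

lemma exists_isNonvanishing_of_sum_eq {r x₁ x₂ x₃ : ℂ} {N k : ℕ} (hr : 2 * r = N) (hN : 3 ≤ N)
    (hS : x₁ + x₂ + x₃ - r = -(k : ℂ))
    (hx₁ : ∀ l : ℕ, x₁ ≠ r + l) (hx₂ : ∀ l : ℕ, x₂ ≠ r + l) (hx₃ : ∀ l : ℕ, x₃ ≠ r + l)
    (h₁₂ : ¬ ((∃ k : ℕ, x₁ = -(k : ℂ)) ∧ ∃ k : ℕ, x₂ = -(k : ℂ)))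
    (h₂₃ : ¬ ((∃ k : ℕ, x₂ = -(k : ℂ)) ∧ ∃ k : ℕ, x₃ = -(k : ℂ)))
    (h₃₁ : ¬ ((∃ k : ℕ, x₃ = -(k : ℂ)) ∧ ∃ k : ℕ, x₁ = -(k : ℂ))) :
    ∃ a₁ a₂ a₃ : ℕ, IsNonvanishing r x₁ x₂ x₃ a₁ a₂ a₃ := by
  have z₁ := isAdmissible_zero hx₁
  have z₂ := isAdmissible_zero hx₂
  have z₃ := isAdmissible_zero hx₃
  obtain f₁ | ⟨B₁, hB₁, e₁⟩ := isAdmissible_cases hr (by omega) hx₁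
  · exact ⟨k, 0, 0, (f₁ k).isNonvanishing (by simpa using hS) z₂ z₃⟩
  obtain f₂ | ⟨B₂, hB₂, e₂⟩ := isAdmissible_cases hr (by omega) hx₂
  · exact ⟨0, k, 0, z₁.isNonvanishing (by simpa using hS) (f₂ k) z₃⟩
  obtain f₃ | ⟨B₃, hB₃, e₃⟩ := isAdmissible_cases hr (by omega) hx₃
  · exact ⟨0, 0, k, z₁.isNonvanishing (by simpa using hS) z₂ (f₃ k)⟩
  have hk : k ≤ B₁ + B₂ + B₃ := by
    have one_neg {x y z : ℂ} {A B C : ℕ} (h : x + y + z - r = -(k : ℂ)) (hx : x = -(A : ℂ))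
        (hy : y = r - ((B + 1 : ℕ) : ℂ)) (hz : z = r - ((C + 1 : ℕ) : ℂ)) : k ≤ A + B + C := by
      have h' : ((2 * k + N : ℕ) : ℂ) = ((2 * A + 2 * B + 2 * C + 4 : ℕ) : ℂ) := by
        push_cast at hy hz ⊢
        linear_combination 2 * h - 2 * hx - 2 * hy - 2 * hz - hr
      have := Nat.cast_injective h'
      omega
    rcases e₁ with e₁ | e₁ <;> rcases e₂ with e₂ | e₂ <;> rcases e₃ with e₃ | e₃
    · exact absurd ⟨⟨_, e₁⟩, _, e₂⟩ h₁₂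
    · exact absurd ⟨⟨_, e₁⟩, _, e₂⟩ h₁₂
    · exact absurd ⟨⟨_, e₃⟩, _, e₁⟩ h₃₁
    · exact one_neg hS e₁ e₂ e₃
    · exact absurd ⟨⟨_, e₂⟩, _, e₃⟩ h₂₃
    · have := one_neg (by linear_combination hS) e₂ e₁ e₃
      omega
    · have := one_neg (by linear_combination hS) e₃ e₁ e₂
      omega
    · have h' : ((k + N : ℕ) : ℂ) = ((B₁ + B₂ + B₃ + 3 : ℕ) : ℂ) := by
        push_cast at e₁ e₂ e₃ ⊢
        linear_combination hS - e₁ - e₂ - e₃ - hr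
      have := Nat.cast_injective h'
      omega
  obtain ⟨a₁, ha₁, a₂, ha₂, a₃, ha₃, rfl⟩ := exists_le_add_add_eq hk
  exact ⟨a₁, a₂, a₃, (hB₁ a₁ ha₁).isNonvanishing hS (hB₂ a₂ ha₂) (hB₃ a₃ ha₃)⟩

lemma forall_not_isNonvanishing_iff {r x₁ x₂ x₃ : ℂ} {N : ℕ} (hr : 2 * r = N) (hN : 3 ≤ N) :
    (∀ a₁ a₂ a₃ : ℕ, ¬ IsNonvanishing r x₁ x₂ x₃ a₁ a₂ a₃) ↔
      (((∃ k : ℕ, x₁ = -(k : ℂ)) ∧ ∃ k : ℕ, x₂ = -(k : ℂ)) ∨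
        ((∃ k : ℕ, x₂ = -(k : ℂ)) ∧ ∃ k : ℕ, x₃ = -(k : ℂ)) ∨
        ((∃ k : ℕ, x₃ = -(k : ℂ)) ∧ ∃ k : ℕ, x₁ = -(k : ℂ))) ∨
      ((∃ k : ℕ, x₁ + x₂ + x₃ - r = -(k : ℂ)) ∧
        ((∃ l : ℕ, x₁ = r + l) ∨ (∃ l : ℕ, x₂ = r + l) ∨ ∃ l : ℕ, x₃ = r + l)) := by
  constructor
  · contrapose!
    rintro ⟨⟨h₁₂, h₂₃, h₃₁⟩, hsum⟩
    by_cases hS : ∃ k : ℕ, x₁ + x₂ + x₃ - r = -(k : ℂ)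
    · obtain ⟨hx₁, hx₂, hx₃⟩ := hsum hS
      obtain ⟨k, hk⟩ := hS
      refine exists_isNonvanishing_of_sum_eq hr hN hk hx₁ hx₂ hx₃ ?_ ?_ ?_
      exacts [fun ⟨h, k, hk⟩ => h₁₂ h k hk, fun ⟨h, k, hk⟩ => h₂₃ h k hk,
        fun ⟨h, k, hk⟩ => h₃₁ h k hk]
    · refine exists_isNonvanishing_of_sum_ne (by simpa using hS) ?_ ?_ ?_
      exacts [fun ⟨h, k, hk⟩ => h₁₂ h k hk, fun ⟨h, k, hk⟩ => h₂₃ h k hk,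
        fun ⟨h, k, hk⟩ => h₃₁ h k hk]
  · rintro ((⟨⟨_, h⟩, _, h'⟩ | ⟨⟨_, h⟩, _, h'⟩ | ⟨⟨_, h⟩, _, h'⟩) | ⟨⟨k, hS⟩, ⟨_, h⟩ | ⟨_, h⟩ | ⟨_, h⟩⟩)
      a₁ a₂ a₃ hne
    · exact not_isNonvanishing_of_neg_natCast h h' _ _ _ hne
    · exact not_isNonvanishing_of_neg_natCast h h' _ _ _ hne.rotate
    · exact not_isNonvanishing_of_neg_natCast h h' _ _ _ hne.rotate.rotate
    · exact not_isNonvanishing_of_sum (k := k) (by linear_combination hS) h _ _ _ hne.rotate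
    · exact not_isNonvanishing_of_sum (k := k) (by linear_combination hS) h _ _ _ hne.rotate.rotate
    · exact not_isNonvanishing_of_sum hS h _ _ _ hne

lemma memZ_iff (n : ℕ) (α₁ α₂ α₃ : ℂ) :
    memZ n α₁ α₂ α₃ ↔
      (((∃ k : ℕ, α₁ / 2 + rhoC n = -(k : ℂ)) ∧ ∃ k : ℕ, α₂ / 2 + rhoC n = -(k : ℂ)) ∨
        ((∃ k : ℕ, α₂ / 2 + rhoC n = -(k : ℂ)) ∧ ∃ k : ℕ, α₃ / 2 + rhoC n = -(k : ℂ)) ∨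
        ((∃ k : ℕ, α₃ / 2 + rhoC n = -(k : ℂ)) ∧ ∃ k : ℕ, α₁ / 2 + rhoC n = -(k : ℂ))) ∨
      ((∃ k : ℕ, (α₁ / 2 + rhoC n) + (α₂ / 2 + rhoC n) + (α₃ / 2 + rhoC n) - rhoC n = -(k : ℂ)) ∧
        ((∃ l : ℕ, α₁ / 2 + rhoC n = rhoC n + l) ∨ (∃ l : ℕ, α₂ / 2 + rhoC n = rhoC n + l) ∨
          ∃ l : ℕ, α₃ / 2 + rhoC n = rhoC n + l)) := by
  have hneg (α : ℂ) (k : ℕ) : α / 2 + rhoC n = -(k : ℂ) ↔ α = -((n : ℂ) - 1) - 2 * k := by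
    rw [rhoC]
    exact ⟨fun h => by linear_combination 2 * h, fun h => by linear_combination h / 2⟩
  have hsum (k : ℕ) :
      (α₁ / 2 + rhoC n) + (α₂ / 2 + rhoC n) + (α₃ / 2 + rhoC n) - rhoC n = -(k : ℂ) ↔
        α₁ + α₂ + α₃ = -2 * ((n : ℂ) - 1) - 2 * k := by
    rw [rhoC]
    exact ⟨fun h => by linear_combination 2 * h, fun h => by linear_combination h / 2⟩
  have hpos (α : ℂ) (l : ℕ) : α / 2 + rhoC n = rhoC n + l ↔ α = 2 * (l : ℂ) :=
    ⟨fun h => by linear_combination 2 * h, fun h => by linear_combination h / 2⟩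
  simp only [memZ, hneg, hsum, hpos]
  refine or_congr ⟨?_, ?_⟩ (and_congr_right fun _ => ?_)
  · rintro ⟨i, j, hij, hi, hj⟩
    fin_cases i <;> fin_cases j
    exacts [absurd rfl hij, .inl ⟨hi, hj⟩, .inr (.inr ⟨hj, hi⟩),
      .inl ⟨hj, hi⟩, absurd rfl hij, .inr (.inl ⟨hi, hj⟩),
      .inr (.inr ⟨hi, hj⟩), .inr (.inl ⟨hj, hi⟩), absurd rfl hij]
  · rintro (⟨h, h'⟩ | ⟨h, h'⟩ | ⟨h, h'⟩)
    exacts [⟨0, 1, by decide, h, h'⟩, ⟨1, 2, by decide, h, h'⟩, ⟨2, 0, by decide, h, h'⟩]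
  · simp [Fin.exists_fin_succ]

/-- determination of the zero set `Z` of the normalized family. -/
theorem Ival_eq_zero_iff_memZ (n : ℕ) (hn : 4 ≤ n) (α₁ α₂ α₃ : ℂ) :
    (∀ a₁ a₂ a₃ : ℕ, Ival n α₁ α₂ α₃ a₁ a₂ a₃ = 0) ↔ memZ n α₁ α₂ α₃ := by
  have hr : 2 * rhoC n = ((n - 1 : ℕ) : ℂ) := by
    rw [rhoC, Nat.cast_sub (by omega)]
    push_cast
    ring
  rw [memZ_iff, ← forall_not_isNonvanishing_iff hr (by omega)]
  simp only [← Ival_ne_zero_iff, not_not]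
end

section
/- Let n ≥ 4 and ρ = (n−1)/2, and let α = (α₁,α₂,α₃) ∈ ℂ³ satisfy I_α(a₁,a₂,a₃) = 0 for all (a₁,a₂,a₃) ∈ ℕ³. Then either α ∈ Z, or there exist k, l ∈ ℕ with k > l and two distinct indices i ≠ j in {1,2,3} such that α₁+α₂+α₃ = −2(n−1)−2k and α_i+α_j = −2(n−1)−2l. -/
open Polynomial

theorem exists_eq_neg_nat_of_poch_eq_zero {z : ℂ} {m : ℕ} (h : poch z m = 0) :
    ∃ k : ℕ, z = -k := by
  obtain ⟨k, -, hk⟩ := (ascPochhammer_eval_eq_zero_iff m z).1 h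
  exact ⟨k, by rw [hk, neg_neg]⟩

theorem poch_zero (z : ℂ) : poch z 0 = 1 := by simp [poch]

theorem Complex.Gamma_ne_zero_add_natCast {z : ℂ} {m k : ℕ} (hm : -z.re < m) (hmk : m ≤ k) :
    Complex.Gamma (z + k) ≠ 0 := by
  apply Complex.Gamma_ne_zero_of_re_pos
  have : (m : ℝ) ≤ k := by exact_mod_cast hmk
  simp only [Complex.add_re, Complex.natCast_re]
  linarith

/-- The factors of `Ival`, one of which vanishes if `Ival` does. -/
theorem factor_eq_zero_of_Ival_eq_zero {n : ℕ} {α₁ α₂ α₃ : ℂ} {a₁ a₂ a₃ : ℕ}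
    (h : Ival n α₁ α₂ α₃ a₁ a₂ a₃ = 0) :
    poch ((α₁ + α₂ + α₃) / 2 + 2 * rhoC n) (a₁ + a₂ + a₃) = 0 ∨
      poch (α₁ / 2 + rhoC n) a₁ = 0 ∨ poch (α₂ / 2 + rhoC n) a₂ = 0 ∨
      poch (α₃ / 2 + rhoC n) a₃ = 0 ∨
      Complex.Gamma ((α₁ + α₂) / 2 + 2 * rhoC n + (a₁ + a₂ : ℕ)) = 0 ∨
      Complex.Gamma ((α₂ + α₃) / 2 + 2 * rhoC n + (a₂ + a₃ : ℕ)) = 0 ∨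
      Complex.Gamma ((α₃ + α₁) / 2 + 2 * rhoC n + (a₃ + a₁ : ℕ)) = 0 := by
  have hpi : (((Real.pi / 2) ^ (3 * ((n : ℝ) - 1) / 2) : ℝ) : ℂ) ≠ 0 :=
    Complex.ofReal_ne_zero.2 (by positivity)
  have htwo : (2 : ℂ) ^ (α₁ + α₂ + α₃ + 2 * ((a₁ : ℂ) + (a₂ : ℂ) + (a₃ : ℂ))) ≠ 0 := by
    simp [Complex.cpow_eq_zero_iff]
  simp only [Ival, div_eq_zero_iff, mul_eq_zero, hpi, htwo, false_or] at h
  push_cast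
  simp only [← add_assoc]
  tauto

/-- If `α₁ + α₂ + α₃` lies in `-2(n-1) - 2ℕ` and some `αᵢ + αⱼ` lies in `-2(n-1) - 2ℕ`, then
either the remaining `αₘ` is in `2ℕ`, or the pair is as in the second alternative. -/
theorem memZ_or_typeII_of_sum_of_pair {n : ℕ} {α₁ α₂ α₃ : ℂ} {k l : ℕ} (i j m : Fin 3)
    (hij : i ≠ j) (hsum : α₁ + α₂ + α₃ = -2 * ((n : ℂ) - 1) - 2 * k)
    (hpair : ![α₁, α₂, α₃] i + ![α₁, α₂, α₃] j = -2 * ((n : ℂ) - 1) - 2 * l)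
    (hijm : ![α₁, α₂, α₃] i + ![α₁, α₂, α₃] j + ![α₁, α₂, α₃] m = α₁ + α₂ + α₃) :
    memZ n α₁ α₂ α₃ ∨
      ∃ k l : ℕ, l < k ∧ ∃ i j : Fin 3, i ≠ j ∧
        α₁ + α₂ + α₃ = -2 * ((n : ℂ) - 1) - 2 * k ∧
        ![α₁, α₂, α₃] i + ![α₁, α₂, α₃] j = -2 * ((n : ℂ) - 1) - 2 * l := by
  rcases lt_or_ge l k with hlk | hkl
  · exact Or.inr ⟨k, l, hlk, i, j, hij, hsum, hpair⟩
  · refine Or.inl (Or.inr ⟨⟨k, hsum⟩, m, l - k, ?_⟩)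
    rw [Nat.cast_sub hkl]
    linear_combination hijm - hpair + hsum

/-- reduction of the vanishing problem. -/
theorem memZ_or_typeII_of_Ival_eq_zero (n : ℕ) (hn : 4 ≤ n) (α₁ α₂ α₃ : ℂ)
    (h : ∀ a₁ a₂ a₃ : ℕ, Ival n α₁ α₂ α₃ a₁ a₂ a₃ = 0) :
    memZ n α₁ α₂ α₃ ∨
      ∃ k l : ℕ, l < k ∧ ∃ i j : Fin 3, i ≠ j ∧
        α₁ + α₂ + α₃ = -2 * ((n : ℂ) - 1) - 2 * k ∧
        ![α₁, α₂, α₃] i + ![α₁, α₂, α₃] j = -2 * ((n : ℂ) - 1) - 2 * l := by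
  have hGamma {z : ℂ} (hz : Complex.Gamma (z / 2 + 2 * rhoC n) = 0) :
      ∃ l : ℕ, z = -2 * ((n : ℂ) - 1) - 2 * l := by
    obtain ⟨l, hl⟩ := (Complex.Gamma_eq_zero_iff _).1 hz
    exact ⟨l, by rw [rhoC] at hl; linear_combination 2 * hl⟩
  have hpoch {z : ℂ} {m : ℕ} (hz : poch (z / 2 + rhoC n) m = 0) :
      ∃ k : ℕ, z = -((n : ℂ) - 1) - 2 * k := by
    obtain ⟨k, hk⟩ := exists_eq_neg_nat_of_poch_eq_zero hz
    exact ⟨k, by rw [rhoC] at hk; linear_combination 2 * hk⟩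
  by_cases hs : ∃ k : ℕ, α₁ + α₂ + α₃ = -2 * ((n : ℂ) - 1) - 2 * k
  · obtain ⟨k, hk⟩ := hs
    have h0 := factor_eq_zero_of_Ival_eq_zero (h 0 0 0)
    simp only [add_zero, Nat.cast_zero, poch_zero, one_ne_zero, false_or] at h0
    rcases h0 with h0 | h0 | h0 <;> obtain ⟨l, hl⟩ := hGamma h0
    · exact memZ_or_typeII_of_sum_of_pair 0 1 2 (by decide) hk hl rfl
    · exact memZ_or_typeII_of_sum_of_pair 1 2 0 (by decide) hk hl
        (by simp only [Matrix.cons_val]; ring)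
    · exact memZ_or_typeII_of_sum_of_pair 2 0 1 (by decide) hk hl
        (by simp only [Matrix.cons_val]; ring)
  · left
    left
    have hs' (m : ℕ) : poch ((α₁ + α₂ + α₃) / 2 + 2 * rhoC n) m ≠ 0 := fun hm => by
      obtain ⟨k, hk⟩ := exists_eq_neg_nat_of_poch_eq_zero hm
      exact hs ⟨k, by rw [rhoC] at hk; linear_combination 2 * hk⟩
    obtain ⟨M₃, h₃⟩ := exists_nat_gt (-((α₁ + α₂) / 2 + 2 * rhoC n).re)
    obtain ⟨M₁, h₁⟩ := exists_nat_gt (-((α₂ + α₃) / 2 + 2 * rhoC n).re)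
    obtain ⟨M₂, h₂⟩ := exists_nat_gt (-((α₃ + α₁) / 2 + 2 * rhoC n).re)
    let M := M₁ + M₂ + M₃
    have key (a₁ a₂ a₃ : ℕ) (h₁₂ : M ≤ a₁ + a₂) (h₂₃ : M ≤ a₂ + a₃) (h₃₁ : M ≤ a₃ + a₁) :
        poch (α₁ / 2 + rhoC n) a₁ = 0 ∨ poch (α₂ / 2 + rhoC n) a₂ = 0 ∨
          poch (α₃ / 2 + rhoC n) a₃ = 0 := by
      have := factor_eq_zero_of_Ival_eq_zero (h a₁ a₂ a₃)
      have g₃ := Complex.Gamma_ne_zero_add_natCast h₃ (show M₃ ≤ a₁ + a₂ by omega)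
      have g₁ := Complex.Gamma_ne_zero_add_natCast h₁ (show M₁ ≤ a₂ + a₃ by omega)
      have g₂ := Complex.Gamma_ne_zero_add_natCast h₂ (show M₂ ≤ a₃ + a₁ by omega)
      have := hs' (a₁ + a₂ + a₃)
      tauto
    have k₁ := key 0 M M (by omega) (by omega) (by omega)
    have k₂ := key M 0 M (by omega) (by omega) (by omega)
    have k₃ := key M M 0 (by omega) (by omega) (by omega)
    simp only [poch_zero, one_ne_zero, false_or, or_false] at k₁ k₂ k₃
    by_cases p₁ : poch (α₁ / 2 + rhoC n) M = 0
    · rcases k₁ with p₂ | p₃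
      · exact ⟨0, 1, by decide, hpoch p₁, hpoch p₂⟩
      · exact ⟨0, 2, by decide, hpoch p₁, hpoch p₃⟩
    · exact ⟨1, 2, by decide, hpoch (k₃.resolve_left p₁), hpoch (k₂.resolve_left p₁)⟩
end

section
/- Let n ≥ 4 be an integer and let k, l, m ∈ ℕ satisfy l < k, m < k, k < l + m + (n−1) and l + m + (n−1) ≤ 2k. Then there exist a₁, a₂, a₃ ∈ ℕ such that a₂ + a₃ ≥ l + 1, a₁ + a₃ ≥ m + 1, a₁ + a₂ > 2k − l − m − (n−1), and a₁ + a₂ + a₃ ≤ k. -/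
/-- the combinatorial existence statement (system (6.2) of the paper),
used in case (B) of the determination of the zero set. -/
theorem exists_abc_system (n k l m : ℕ) (hn : 4 ≤ n)
    (hl : l < k) (hm : m < k)
    (h₁ : (k : ℤ) < (l : ℤ) + m + ((n : ℤ) - 1))
    (h₂ : (l : ℤ) + m + ((n : ℤ) - 1) ≤ 2 * k) :
    ∃ a₁ a₂ a₃ : ℕ,
      l + 1 ≤ a₂ + a₃ ∧
      m + 1 ≤ a₁ + a₃ ∧
      2 * (k : ℤ) - l - m - ((n : ℤ) - 1) < (a₁ : ℤ) + a₂ ∧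
      a₁ + a₂ + a₃ ≤ k := by
  refine ⟨k - l - 1, min (k - m - 1) (l + 1), k - (k - l - 1) - min (k - m - 1) (l + 1),
    ?_, ?_, ?_, ?_⟩ <;> omega
end

section
/- Let n ≥ 4, ρ = (n−1)/2, k ∈ ℕ, and let λ = (λ₁,λ₂,λ₃) ∈ ℂ³ satisfy λ₁+λ₂+λ₃ = −ρ−2k. Then λ ∈ Z^λ if and only if at least one of the following holds: (i) λ₁+λ₂ ∈ −k+ℕ; (ii) λ₁ ∈ −ρ−k−ℕ; (iii) λ₂ ∈ −ρ−k−ℕ; (iv) λ₁ = −ρ−l for some l ∈ ℕ and λ₂ ∈ {−k, −k+1, …, −k+l}; (v) λ₂ = −ρ−l for some l ∈ ℕ and λ₁ ∈ {−k, −k+1, …, −k+l}; (vi) λ₁ = −k+p and λ₂ = −k+q for some p, q ∈ ℕ with p+q ≤ k. -/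
/-- The zero set `Z` of the normalized family, in the spectral parameter: up to a permutation
of the indices, `λ_h = -ρ - l` and `λ_i ± λ_j = m` with `l ∈ ℕ`, `m ∈ ℤ`, `|m| ≤ l`,
`l ≡ m (mod 2)`. -/
def memZlam (n : ℕ) (lam : Fin 3 → ℂ) : Prop :=
  ∃ σ : Equiv.Perm (Fin 3), ∃ l : ℕ, ∃ m : ℤ,
    m.natAbs ≤ l ∧ (l : ℤ) % 2 = m % 2 ∧
    lam (σ 2) = -(rhoC n) - (l : ℂ) ∧
    (lam (σ 0) - lam (σ 1) = (m : ℂ) ∨ lam (σ 0) + lam (σ 1) = (m : ℂ))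

/-- The condition defining `memZlam` for one ordering of the parameters, with `c` singled out. -/
def IsZeroTriple (n : ℕ) (a b c : ℂ) : Prop :=
  ∃ l : ℕ, ∃ m : ℤ, m.natAbs ≤ l ∧ (l : ℤ) % 2 = m % 2 ∧
    c = -(rhoC n) - (l : ℂ) ∧ (a - b = (m : ℂ) ∨ a + b = (m : ℂ))

theorem IsZeroTriple.swap {n : ℕ} {a b c : ℂ} (h : IsZeroTriple n a b c) :
    IsZeroTriple n b a c := by
  obtain ⟨l, m, hm, hp, hc, h | h⟩ := h
  · exact ⟨l, -m, by omega, by omega, hc, Or.inl (by push_cast; rw [← h]; ring)⟩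
  · exact ⟨l, m, hm, hp, hc, Or.inr (by rw [← h]; ring)⟩

theorem memZlam_iff_isZeroTriple (n : ℕ) (a b c : ℂ) :
    memZlam n ![a, b, c] ↔
      IsZeroTriple n a b c ∨ IsZeroTriple n b c a ∨ IsZeroTriple n a c b := by
  constructor
  · rintro ⟨σ, h⟩
    have h01 : σ 0 ≠ σ 1 := σ.injective.ne (by decide)
    have h02 : σ 0 ≠ σ 2 := σ.injective.ne (by decide)
    have h12 : σ 1 ≠ σ 2 := σ.injective.ne (by decide)
    change IsZeroTriple n (![a, b, c] (σ 0)) (![a, b, c] (σ 1)) (![a, b, c] (σ 2)) at h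
    generalize σ 0 = i at *
    generalize σ 1 = j at *
    generalize σ 2 = r at *
    fin_cases i <;> fin_cases j <;> fin_cases r <;>
      first
      | exact absurd rfl h01
      | exact absurd rfl h02
      | exact absurd rfl h12
      | exact Or.inl h
      | exact Or.inl h.swap
      | exact Or.inr (Or.inl h)
      | exact Or.inr (Or.inl h.swap)
      | exact Or.inr (Or.inr h)
      | exact Or.inr (Or.inr h.swap)
  · rintro (h | h | h)
    · exact ⟨1, h⟩
    · exact ⟨Equiv.swap 0 2, IsZeroTriple.swap h⟩
    · exact ⟨Equiv.swap 1 2, h⟩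

/-- On the plane `a + b + c = -ρ - 2k`, the condition on an ordered triple in terms of `c`
and `a` alone. -/
theorem isZeroTriple_iff_of_sum {n k : ℕ} {a b c : ℂ}
    (hsum : a + b + c = -(rhoC n) - 2 * k) :
    IsZeroTriple n a b c ↔
      (∃ m : ℕ, c = -(rhoC n) - k - m) ∨
      (∃ l : ℕ, c = -(rhoC n) - l ∧ ∃ j : ℕ, j ≤ l ∧ a = -(k : ℂ) + j) := by
  constructor
  · rintro ⟨l, m, hm, hp, hc, h | h⟩
    · obtain ⟨j, hj⟩ : ∃ j : ℕ, (l : ℤ) + m = 2 * j := ⟨((l + m) / 2).toNat, by omega⟩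
      refine Or.inr ⟨l, hc, j, by omega, ?_⟩
      have hj' : (l : ℂ) + m = 2 * j := by exact_mod_cast hj
      linear_combination (hsum - hc + h + hj') / 2
    · have hlm : (m : ℂ) = l - 2 * k := by linear_combination hsum - hc - h
      have hlm' : m = (l : ℤ) - 2 * k := by exact_mod_cast hlm
      obtain ⟨d, rfl⟩ : ∃ d, l = k + d := Nat.exists_eq_add_of_le (by omega)
      exact Or.inl ⟨d, by rw [hc]; push_cast; ring⟩
  · rintro (⟨m, hc⟩ | ⟨l, hc, j, hj, ha⟩)
    · refine ⟨k + m, (m : ℤ) - k, by omega, by omega, by rw [hc]; push_cast; ring, Or.inr ?_⟩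
      push_cast
      linear_combination hsum - hc
    · refine ⟨l, 2 * (j : ℤ) - l, by omega, by omega, hc, Or.inl ?_⟩
      push_cast
      linear_combination 2 * ha - hsum + hc

/-- characterization of `Z` on the plane `λ₁+λ₂+λ₃ = -ρ-2k`. -/
theorem memZlam_iff_on_plane (n : ℕ) (hn : 4 ≤ n) (k : ℕ) (lam₁ lam₂ lam₃ : ℂ)
    (hsum : lam₁ + lam₂ + lam₃ = -(rhoC n) - 2 * k) :
    memZlam n ![lam₁, lam₂, lam₃] ↔
      ((∃ m : ℕ, lam₁ + lam₂ = -(k : ℂ) + m) ∨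
       (∃ m : ℕ, lam₁ = -(rhoC n) - k - m) ∨
       (∃ m : ℕ, lam₂ = -(rhoC n) - k - m) ∨
       (∃ l : ℕ, lam₁ = -(rhoC n) - l ∧ ∃ j : ℕ, j ≤ l ∧ lam₂ = -(k : ℂ) + j) ∨
       (∃ l : ℕ, lam₂ = -(rhoC n) - l ∧ ∃ j : ℕ, j ≤ l ∧ lam₁ = -(k : ℂ) + j) ∨
       (∃ p q : ℕ, p + q ≤ k ∧ lam₁ = -(k : ℂ) + p ∧ lam₂ = -(k : ℂ) + q)) := by
  rw [memZlam_iff_isZeroTriple, isZeroTriple_iff_of_sum hsum,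
    isZeroTriple_iff_of_sum (a := lam₂) (b := lam₃) (c := lam₁) (k := k)
      (by rw [← hsum]; ring),
    isZeroTriple_iff_of_sum (a := lam₁) (b := lam₃) (c := lam₂) (k := k)
      (by rw [← hsum]; ring)]
  constructor
  · rintro ((⟨m, h⟩ | ⟨l, h, p, hp, ha⟩) | (h | h) | (h | h))
    · exact Or.inl ⟨m, by linear_combination hsum - h⟩
    · obtain ⟨q, rfl⟩ := Nat.exists_eq_add_of_le hp
      push_cast at h
      rcases le_total (p + q) k with hk | hk
      · exact Or.inr <| Or.inr <| Or.inr <| Or.inr <| Or.inr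
          ⟨p, q, hk, ha, by linear_combination hsum - h - ha⟩
      · obtain ⟨d, hd⟩ := Nat.exists_eq_add_of_le hk
        have hd' : (p : ℂ) + q = k + d := by exact_mod_cast hd
        exact Or.inl ⟨d, by linear_combination hsum - h + hd'⟩
    · exact Or.inr <| Or.inl h
    · exact Or.inr <| Or.inr <| Or.inr <| Or.inl h
    · exact Or.inr <| Or.inr <| Or.inl h
    · exact Or.inr <| Or.inr <| Or.inr <| Or.inr <| Or.inl h
  · rintro (⟨m, h⟩ | h | h | h | h | ⟨p, q, -, hp, hq⟩)
    · exact Or.inl <| Or.inl ⟨m, by linear_combination hsum - h⟩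
    · exact Or.inr <| Or.inl <| Or.inl h
    · exact Or.inr <| Or.inr <| Or.inl h
    · exact Or.inr <| Or.inl <| Or.inr h
    · exact Or.inr <| Or.inr <| Or.inr h
    · refine Or.inl <| Or.inr ⟨p + q, ?_, p, Nat.le_add_right p q, hp⟩
      push_cast
      linear_combination hsum - hp - hq
end

section
/- Let n ≥ 4, ρ = (n−1)/2, k ∈ ℕ, and let (λ₁,λ₂) ∈ ℂ² with (λ₁,λ₂) ∉ Z_k. Then the complex vector space of solutions of the system (S) is one-dimensional: there exists a nonzero solution, and any two solutions are proportional. -/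
/-- `(λ₁, λ₂) ∈ Z_k` iff `(λ₁, λ₂, -ρ-2k-λ₁-λ₂) ∈ Z`. -/
def memZk (n k : ℕ) (lam₁ lam₂ : ℂ) : Prop :=
  memZlam n ![lam₁, lam₂, -(rhoC n) - 2 * k - lam₁ - lam₂]

/-- A solution of the system (S): a family `c_{r,t}` (indexed by `ℤ × ℤ`, vanishing outside
`{r ≥ 0, t ≥ 0, r + t ≤ k}`) satisfying the equations `E¹_{r,t}` and `E²_{r,t}`. -/
def IsSolS (n k : ℕ) (lam₁ lam₂ : ℂ) (c : ℤ → ℤ → ℂ) : Prop :=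
  (∀ r t : ℤ, (r < 0 ∨ t < 0 ∨ (k : ℤ) < r + t) → c r t = 0) ∧
  (∀ r t : ℤ, 0 ≤ r → 0 ≤ t → r + t ≤ (k : ℤ) →
    4 * ((r : ℂ) + 1) * ((r : ℂ) + 1 + lam₁) * c (r + 1) t +
      2 * ((k : ℂ) - r - t) * ((k : ℂ) - r + t - 1 + rhoC n + lam₂) * c r t -
      ((k : ℂ) - r - t + 1) * ((k : ℂ) - r - t) * c r (t - 1) = 0) ∧
  (∀ r t : ℤ, 0 ≤ r → 0 ≤ t → r + t ≤ (k : ℤ) →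
    4 * ((t : ℂ) + 1) * ((t : ℂ) + 1 + lam₂) * c r (t + 1) +
      2 * ((k : ℂ) - r - t) * ((k : ℂ) + r - t - 1 + rhoC n + lam₁) * c r t -
      ((k : ℂ) - r - t + 1) * ((k : ℂ) - r - t) * c (r - 1) t = 0)

namespace IsSolS

variable {n k : ℕ} {lam₁ lam₂ : ℂ}

/-- Exchanging the two indices exchanges the two spectral parameters. -/
lemma swap {c : ℤ → ℤ → ℂ} (hc : IsSolS n k lam₁ lam₂ c) :
    IsSolS n k lam₂ lam₁ (fun r t => c t r) := by
  obtain ⟨h0, h1, h2⟩ := hc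
  refine ⟨fun r t h => h0 t r (by omega), fun r t hr ht hk => ?_, fun r t hr ht hk => ?_⟩
  · linear_combination h2 t r ht hr (by omega)
  · linear_combination h1 t r ht hr (by omega)

lemma sub_mul {c d : ℤ → ℤ → ℂ} (hc : IsSolS n k lam₁ lam₂ c) (hd : IsSolS n k lam₁ lam₂ d)
    (a : ℂ) : IsSolS n k lam₁ lam₂ (fun r t => c r t - a * d r t) := by
  obtain ⟨h0, h1, h2⟩ := hc
  obtain ⟨g0, g1, g2⟩ := hd
  refine ⟨fun r t h => ?_, fun r t hr ht hk => ?_, fun r t hr ht hk => ?_⟩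
  · simp [h0 r t h, g0 r t h]
  · linear_combination h1 r t hr ht hk - a * g1 r t hr ht hk
  · linear_combination h2 r t hr ht hk - a * g2 r t hr ht hk

/-- The second equation propagates vanishing along a row. -/
lemma row_eq_zero {c : ℤ → ℤ → ℂ} (hc : IsSolS n k lam₁ lam₂ c)
    (hB : ∀ t : ℕ, 1 ≤ t → t ≤ k → (t : ℂ) + lam₂ ≠ 0) {r : ℤ}
    (hprev : ∀ t, c (r - 1) t = 0) (h0 : c r 0 = 0) (t : ℤ) : c r t = 0 := by
  have key : ∀ t : ℕ, c r t = 0 := by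
    intro t
    induction t with
    | zero => simpa using h0
    | succ t ih =>
      by_cases hr : r < 0 ∨ (k : ℤ) < r + (t + 1 : ℕ)
      · exact hc.1 _ _ (by omega)
      · have e := hc.2.2 r t (by omega) (by omega) (by omega)
        rw [ih, hprev] at e
        have hb := hB (t + 1) (by omega) (by omega)
        have ht : ((t : ℂ) + 1) ≠ 0 := by exact_mod_cast Nat.succ_ne_zero t
        push_cast at hb e ⊢
        simpa [ht, hb] using e
  rcases lt_or_ge t 0 with ht | ht
  · exact hc.1 _ _ (by omega)
  · lift t to ℕ using ht
    exact key t

/-- A solution vanishing for `r < p` and at `(p, 0)` is zero. -/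
lemma eq_zero_of_start {c : ℤ → ℤ → ℂ} (hc : IsSolS n k lam₁ lam₂ c) (p : ℕ)
    (hA : ∀ r : ℕ, p < r → r ≤ k → (r : ℂ) + lam₁ ≠ 0)
    (hB : ∀ t : ℕ, 1 ≤ t → t ≤ k → (t : ℂ) + lam₂ ≠ 0)
    (hlt : ∀ r t : ℤ, r < p → c r t = 0) (h0 : c p 0 = 0) (r t : ℤ) : c r t = 0 := by
  have key : ∀ (i : ℕ) (t : ℤ), c ((p + i : ℕ) : ℤ) t = 0 := by
    intro i
    induction i with
    | zero => exact row_eq_zero hc hB (fun t => hlt _ _ (by simp)) (by simpa using h0)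
    | succ i ih =>
      intro t
      by_cases ht : t < 0 ∨ (k : ℤ) < ((p + (i + 1) : ℕ) : ℤ) + t
      · exact hc.1 _ _ (by omega)
      · have e := hc.2.1 ((p + i : ℕ) : ℤ) t (by omega) (by omega) (by omega)
        rw [ih, ih] at e
        have ha := hA (p + i + 1) (by omega) (by omega)
        have hr : (((p + i : ℕ) : ℂ) + 1) ≠ 0 := by exact_mod_cast Nat.succ_ne_zero (p + i)
        have e2 : ((p + (i + 1) : ℕ) : ℤ) = ((p + i : ℕ) : ℤ) + 1 := by push_cast; ring
        rw [e2]
        push_cast at hr ha e ⊢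
        simpa [hr, ha] using e
  rcases lt_or_ge r p with hr | hr
  · exact hlt r t hr
  · obtain ⟨i, hi⟩ := Int.eq_ofNat_of_zero_le (sub_nonneg.2 hr)
    have : r = ((p + i : ℕ) : ℤ) := by push_cast; omega
    rw [this]
    exact key i t

/-- The first equation propagates vanishing from column `r + 1` to column `r`. -/
lemma column_eq_zero {c : ℤ → ℤ → ℂ} (hc : IsSolS n k lam₁ lam₂ c) (r T : ℕ) (hT : r + T < k)
    (hnext : ∀ t : ℕ, t ≤ T → ((r : ℂ) + 1 + lam₁) * c ((r : ℤ) + 1) t = 0)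
    (hne : ∀ t : ℕ, t ≤ T → (k : ℂ) - r + t - 1 + rhoC n + lam₂ ≠ 0) :
    ∀ t : ℕ, t ≤ T → c r t = 0 := by
  intro t
  induction t with
  | zero =>
    intro ht
    have e := hc.2.1 r (0 : ℕ) (by omega) (by omega) (by omega)
    rw [hc.1 r (((0 : ℕ) : ℤ) - 1) (by omega)] at e
    have hs : (k : ℂ) - r - (0 : ℕ) ≠ 0 := by
      rw [Nat.cast_zero, sub_zero]
      exact sub_ne_zero.2 (by exact_mod_cast (by omega : k ≠ r))
    refine (mul_eq_zero.1 ?_).resolve_left (mul_ne_zero hs (hne 0 ht))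
    have e1 := hnext 0 ht
    push_cast at e e1 ⊢
    linear_combination e / 2 - 2 * ((r : ℂ) + 1) * e1
  | succ t ih =>
    intro ht
    have e := hc.2.1 r (t + 1 : ℕ) (by omega) (by omega) (by omega)
    have e2 : ((t + 1 : ℕ) : ℤ) - 1 = t := by push_cast; ring
    rw [e2, ih (by omega)] at e
    have hs : (k : ℂ) - r - (t + 1 : ℕ) ≠ 0 := by
      rw [sub_sub]
      exact sub_ne_zero.2 (by exact_mod_cast (by omega : k ≠ r + (t + 1)))
    refine (mul_eq_zero.1 ?_).resolve_left (mul_ne_zero hs (hne (t + 1) ht))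
    have e1 := hnext (t + 1) ht
    push_cast at e e1 ⊢
    linear_combination e / 2 - 2 * ((r : ℂ) + 1) * e1

/-- If `λ₁ = -p` then, away from the exceptional set, solutions vanish for `r < p`. -/
lemma eq_zero_of_lt {c : ℤ → ℤ → ℂ} (hc : IsSolS n k lam₁ lam₂ c) (p : ℕ) (hpk : p ≤ k)
    (hp : (p : ℂ) + lam₁ = 0) (hB : ∀ t : ℕ, 1 ≤ t → t ≤ k → (t : ℂ) + lam₂ ≠ 0)
    (hρ : ∀ l : ℕ, k - p ≤ l → lam₂ ≠ -(rhoC n) - l) (r t : ℤ) (hr : r < p) : c r t = 0 := by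
  have hne : ∀ i r t : ℕ, r + 1 + i = p → (k : ℂ) - r + t - 1 + rhoC n + lam₂ ≠ 0 := by
    intro i r t h e
    refine hρ (k - p + i + t) (by omega) ?_
    have : (p : ℂ) = r + 1 + i := by exact_mod_cast h.symm
    push_cast [Nat.cast_sub hpk]
    linear_combination e - this
  have low : ∀ i r : ℕ, r + 1 + i = p → ∀ t : ℕ, t ≤ k - p → c r t = 0 := by
    intro i
    induction i with
    | zero =>
      intro r h
      refine column_eq_zero hc r (k - p) (by omega) (fun t _ => ?_) fun t _ => hne 0 r t h
      have : (p : ℂ) = r + 1 := by exact_mod_cast h.symm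
      rw [← this, hp, zero_mul]
    | succ i ih =>
      intro r h
      refine column_eq_zero hc r (k - p) (by omega) (fun t ht => ?_) fun t _ => hne _ r t h
      have := ih (r + 1) (by omega) t ht
      push_cast at this
      rw [this, mul_zero]
  have all : ∀ r : ℕ, r < p → ∀ t, c r t = 0 := by
    intro r
    induction r with
    | zero =>
      intro h
      exact row_eq_zero hc hB (fun t => hc.1 _ _ (by simp))
        (low (p - 1 - 0) 0 (by omega) 0 (by omega))
    | succ r ih =>
      intro h
      refine row_eq_zero hc hB (fun t => ?_) (low (p - 1 - (r + 1)) (r + 1) (by omega) 0 (by omega))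
      have e : ((r + 1 : ℕ) : ℤ) - 1 = r := by push_cast; ring
      rw [e]
      exact ih (by omega) t
  rcases lt_or_ge r 0 with h | h
  · exact hc.1 _ _ (by omega)
  · lift r to ℕ using h
    exact all r (by omega) t

end IsSolS

/-- The entries `c (p, t)` of the first nonzero column. -/
noncomputable def startColumn (n k : ℕ) (lam₁ lam₂ : ℂ) (p : ℕ) : ℕ → ℂ
  | 0 => 1
  | t + 1 => -(2 * ((k : ℂ) - p - t) * ((k : ℂ) + p - t - 1 + rhoC n + lam₁) *
      startColumn n k lam₁ lam₂ p t) / (4 * ((t : ℂ) + 1) * ((t : ℂ) + 1 + lam₂))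

/-- The column `r = p + i` of the solution starting with column `p`. -/
noncomputable def solColumn (n k : ℕ) (lam₁ lam₂ : ℂ) (p : ℕ) : ℕ → ℤ → ℂ
  | 0, t => if t < 0 then 0 else startColumn n k lam₁ lam₂ p t.toNat
  | i + 1, t =>
    (((k : ℂ) - (p + i) - t + 1) * ((k : ℂ) - (p + i) - t) *
        solColumn n k lam₁ lam₂ p i (t - 1) -
      2 * ((k : ℂ) - (p + i) - t) * ((k : ℂ) - (p + i) + t - 1 + rhoC n + lam₂) *
        solColumn n k lam₁ lam₂ p i t) / (4 * ((p : ℂ) + i + 1) * ((p : ℂ) + i + 1 + lam₁))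

/-- The solution starting with column `p`. -/
noncomputable def sol (n k : ℕ) (lam₁ lam₂ : ℂ) (p : ℕ) (r t : ℤ) : ℂ :=
  if r < p then 0 else solColumn n k lam₁ lam₂ p (r - p).toNat t

section Existence

variable {n k : ℕ} {lam₁ lam₂ : ℂ} {p : ℕ}

lemma startColumn_eq_zero (hp : p ≤ k) (t : ℕ) (ht : k < p + t) :
    startColumn n k lam₁ lam₂ p t = 0 := by
  induction t with
  | zero => omega
  | succ t ih =>
    rw [startColumn]
    rcases Nat.lt_or_ge k (p + t) with h | h
    · rw [ih h]; simp
    · have : (k : ℂ) = p + t := by exact_mod_cast (by omega : k = p + t)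
      rw [this]; simp

lemma solColumn_eq_zero (hp : p ≤ k) (i : ℕ) (t : ℤ) (ht : t < 0 ∨ (k : ℤ) < p + i + t) :
    solColumn n k lam₁ lam₂ p i t = 0 := by
  induction i generalizing t with
  | zero =>
    rw [solColumn]
    split_ifs with h
    · rfl
    · exact startColumn_eq_zero hp _ (by omega)
  | succ i ih =>
    rw [solColumn]
    by_cases h : t < 0 ∨ (k : ℤ) + 1 < p + i + t
    · rw [ih t (by omega), ih (t - 1) (by omega)]; simp
    · by_cases h1 : (k : ℤ) = p + i + t
      · have : (k : ℂ) = p + i + t := by exact_mod_cast h1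
        rw [this]; simp
      · have : (k : ℂ) = p + i + t - 1 := by
          exact_mod_cast (by omega : (k : ℤ) = p + i + t - 1)
        rw [ih t (by omega), this]
        ring

lemma sol_of_lt {r t : ℤ} (h : r < p) : sol n k lam₁ lam₂ p r t = 0 := if_pos h

lemma sol_add (i : ℕ) (t : ℤ) :
    sol n k lam₁ lam₂ p ((p : ℤ) + i) t = solColumn n k lam₁ lam₂ p i t := by
  rw [sol, if_neg (by omega)]
  congr
  omega

lemma sol_eq_zero (hp : p ≤ k) {r t : ℤ} (h : r < 0 ∨ t < 0 ∨ (k : ℤ) < r + t) :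
    sol n k lam₁ lam₂ p r t = 0 := by
  rcases lt_or_ge r p with hr | hr
  · exact sol_of_lt hr
  · obtain ⟨i, hi⟩ := Int.eq_ofNat_of_zero_le (sub_nonneg.2 hr)
    obtain rfl : r = p + i := by omega
    rw [sol_add]
    exact solColumn_eq_zero hp i t (by omega)

lemma sol_start : sol n k lam₁ lam₂ p p 0 = 1 := by
  have := sol_add (n := n) (k := k) (lam₁ := lam₁) (lam₂ := lam₂) (p := p) 0 0
  simpa [solColumn, startColumn] using this

/-- The first equation for `sol`, at every index of the relevant columns. -/
lemma sol_first (hA₀ : (p : ℂ) * (p + lam₁) = 0)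
    (hA : ∀ r : ℕ, p < r → r ≤ k → (r : ℂ) + lam₁ ≠ 0) (r t : ℤ) (hr : r < k) :
    4 * ((r : ℂ) + 1) * ((r : ℂ) + 1 + lam₁) * sol n k lam₁ lam₂ p (r + 1) t +
      2 * ((k : ℂ) - r - t) * ((k : ℂ) - r + t - 1 + rhoC n + lam₂) * sol n k lam₁ lam₂ p r t -
      ((k : ℂ) - r - t + 1) * ((k : ℂ) - r - t) * sol n k lam₁ lam₂ p r (t - 1) = 0 := by
  rcases lt_or_ge r p with h | h
  · rw [sol_of_lt h, sol_of_lt h]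
    rcases lt_or_ge (r + 1) p with h1 | h1
    · rw [sol_of_lt h1]; ring
    · have : (r : ℂ) = p - 1 := by exact_mod_cast (by omega : r = (p : ℤ) - 1)
      rw [this]
      linear_combination 4 * sol n k lam₁ lam₂ p (r + 1) t * hA₀
  · obtain ⟨i, hi⟩ := Int.eq_ofNat_of_zero_le (sub_nonneg.2 h)
    obtain rfl : r = p + i := by omega
    have e : (p : ℤ) + i + 1 = p + (i + 1 : ℕ) := by push_cast; ring
    rw [e, sol_add, sol_add, sol_add, solColumn]
    have ha := hA (p + i + 1) (by omega) (by omega)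
    have hn : (p : ℂ) + i + 1 ≠ 0 := by exact_mod_cast Nat.succ_ne_zero (p + i)
    push_cast at ha ⊢
    field_simp
    ring

/-- The second equation for `sol`, at every index of the relevant columns. -/
lemma sol_second (hp : p ≤ k) (hA₀ : (p : ℂ) * (p + lam₁) = 0)
    (hA : ∀ r : ℕ, p < r → r ≤ k → (r : ℂ) + lam₁ ≠ 0)
    (hB : ∀ t : ℕ, 1 ≤ t → t ≤ k → (t : ℂ) + lam₂ ≠ 0) (r t : ℤ) (hr : r ≤ k) :
    4 * ((t : ℂ) + 1) * ((t : ℂ) + 1 + lam₂) * sol n k lam₁ lam₂ p r (t + 1) +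
      2 * ((k : ℂ) - r - t) * ((k : ℂ) + r - t - 1 + rhoC n + lam₁) * sol n k lam₁ lam₂ p r t -
      ((k : ℂ) - r - t + 1) * ((k : ℂ) - r - t) * sol n k lam₁ lam₂ p (r - 1) t = 0 := by
  rcases lt_or_ge r p with h | h
  · rw [sol_of_lt h, sol_of_lt h, sol_of_lt (by omega)]; ring
  obtain ⟨i, hi⟩ := Int.eq_ofNat_of_zero_le (sub_nonneg.2 h)
  obtain rfl : r = p + i := by omega
  clear hi h
  induction i generalizing t with
  | zero =>
    rw [sol_of_lt (by omega : (p : ℤ) + (0 : ℕ) - 1 < p), sol_add, sol_add]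
    rcases lt_or_ge t 0 with ht | ht
    · rw [solColumn_eq_zero hp 0 t (by omega)]
      rcases lt_or_ge (t + 1) 0 with ht1 | ht1
      · rw [solColumn_eq_zero hp 0 (t + 1) (by omega)]; ring
      · obtain rfl : t = -1 := by omega
        push_cast; ring
    · lift t to ℕ using ht
      have e : (t : ℤ) + 1 = (t + 1 : ℕ) := by push_cast; ring
      rw [e, solColumn, solColumn, if_neg (by omega), if_neg (by omega), Int.toNat_natCast,
        Int.toNat_natCast]
      rcases Nat.lt_or_ge k (p + t) with h | h
      · rw [startColumn_eq_zero hp t h, startColumn_eq_zero hp (t + 1) (by omega)]; ring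
      · rcases h.eq_or_lt with h | h
        · have : (k : ℂ) = p + t := by exact_mod_cast h.symm
          rw [startColumn_eq_zero hp (t + 1) (by omega), this]
          push_cast; ring
        · rw [startColumn]
          have hb := hB (t + 1) (by omega) (by omega)
          have hn : (t : ℂ) + 1 ≠ 0 := by exact_mod_cast Nat.succ_ne_zero t
          push_cast at hb ⊢
          field_simp
          ring
  | succ i ih =>
    have hr' : (p : ℤ) + i < k := by push_cast at hr; omega
    have e : (p : ℤ) + (i + 1 : ℕ) = p + i + 1 := by push_cast; ring
    have ha := hA (p + i + 1) (by omega) (by omega)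
    have hn : (p : ℂ) + i + 1 ≠ 0 := by exact_mod_cast Nat.succ_ne_zero (p + i)
    have x0 := ih t hr'.le
    have x1 := ih (t - 1) hr'.le
    have y0 := sol_first (n := n) (lam₂ := lam₂) hA₀ hA (p + i) t hr'
    have y1 := sol_first (n := n) (lam₂ := lam₂) hA₀ hA (p + i) (t + 1) hr'
    have y2 := sol_first (n := n) (lam₂ := lam₂) hA₀ hA (p + i - 1) t (by omega)
    rw [e]
    push_cast at ha
    simp only [sub_add_cancel, add_sub_cancel_right] at x1 y1 y2 ⊢
    refine (mul_eq_zero.1 ?_).resolve_left (mul_ne_zero hn ha)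
    push_cast at x0 x1 y0 y1 y2 ⊢
    set s : ℂ := (k : ℂ) - (p + i) - t with hs
    linear_combination (1 / 4 : ℂ) * (-2 * (s - 1) * (s + 2 * t + rhoC n + lam₂) * x0 +
      s * (s - 1) * x1 + 4 * ((t : ℂ) + 1) * ((t : ℂ) + 1 + lam₂) * y1 +
      2 * (s - 1) * (s + 2 * (p + i) + rhoC n + lam₁) * y0 - s * (s - 1) * y2)

lemma sol_isSolS (hp : p ≤ k) (hA₀ : (p : ℂ) * (p + lam₁) = 0)
    (hA : ∀ r : ℕ, p < r → r ≤ k → (r : ℂ) + lam₁ ≠ 0)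
    (hB : ∀ t : ℕ, 1 ≤ t → t ≤ k → (t : ℂ) + lam₂ ≠ 0) :
    IsSolS n k lam₁ lam₂ (sol n k lam₁ lam₂ p) := by
  refine ⟨fun r t h => sol_eq_zero hp h, fun r t hr ht hk => ?_,
    fun r t _ ht hk => sol_second hp hA₀ hA hB r t (by omega)⟩
  rcases lt_or_ge r k with h | h
  · exact sol_first hA₀ hA r t h
  · obtain rfl : r = k := by omega
    obtain rfl : t = 0 := by omega
    rw [sol_eq_zero hp (r := (k : ℤ) + 1) (by omega)]
    push_cast
    ring

end Existence

/-- One-dimensionality of the solution space of (S). -/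
def UniqueSolS (n k : ℕ) (lam₁ lam₂ : ℂ) : Prop :=
  ∃ c₀ : ℤ → ℤ → ℂ, IsSolS n k lam₁ lam₂ c₀ ∧ c₀ ≠ 0 ∧
    ∀ c : ℤ → ℤ → ℂ, IsSolS n k lam₁ lam₂ c → ∃ a : ℂ, ∀ r t : ℤ, c r t = a * c₀ r t

lemma UniqueSolS.swap {n k : ℕ} {lam₁ lam₂ : ℂ} (h : UniqueSolS n k lam₁ lam₂) :
    UniqueSolS n k lam₂ lam₁ := by
  obtain ⟨c₀, h0, hne, h1⟩ := h
  refine ⟨fun r t => c₀ t r, h0.swap, fun e => hne ?_, fun c hc => ?_⟩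
  · funext r t
    exact congrFun (congrFun e t) r
  · obtain ⟨a, ha⟩ := h1 _ hc.swap
    exact ⟨a, fun r t => ha t r⟩

lemma uniqueSolS_of_start {n k : ℕ} {lam₁ lam₂ : ℂ} (p : ℕ) (hp : p ≤ k)
    (hA₀ : (p : ℂ) * (p + lam₁) = 0)
    (hA : ∀ r : ℕ, p < r → r ≤ k → (r : ℂ) + lam₁ ≠ 0)
    (hB : ∀ t : ℕ, 1 ≤ t → t ≤ k → (t : ℂ) + lam₂ ≠ 0)
    (hlt : ∀ c, IsSolS n k lam₁ lam₂ c → ∀ r t : ℤ, r < p → c r t = 0) :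
    UniqueSolS n k lam₁ lam₂ := by
  have h0 : IsSolS n k lam₁ lam₂ (sol n k lam₁ lam₂ p) := sol_isSolS hp hA₀ hA hB
  refine ⟨_, h0, fun e => ?_, fun c hc => ⟨c p 0, fun r t => ?_⟩⟩
  · have := sol_start (n := n) (k := k) (lam₁ := lam₁) (lam₂ := lam₂) (p := p)
    rw [e] at this
    simp at this
  · have hd := hc.sub_mul h0 (c p 0)
    exact sub_eq_zero.1 (hd.eq_zero_of_start p hA hB (hlt _ hd) (by simp [sol_start]) r t)

lemma memZk_swap {n k : ℕ} {lam₁ lam₂ : ℂ} (h : memZk n k lam₁ lam₂) : memZk n k lam₂ lam₁ := by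
  obtain ⟨σ, l, m, h1, h2, h3⟩ := h
  refine ⟨σ.trans (Equiv.swap 0 1), l, m, h1, h2, ?_⟩
  have e : ∀ x, ![lam₂, lam₁, -(rhoC n) - 2 * k - lam₂ - lam₁] (Equiv.swap 0 1 x) =
      ![lam₁, lam₂, -(rhoC n) - 2 * k - lam₁ - lam₂] x := by
    intro x
    fin_cases x
    · simp
    · simp
    · rw [Equiv.swap_apply_of_ne_of_ne (by simp) (by simp)]
      simp
      ring
  simpa only [Equiv.trans_apply, e] using h3

lemma memZk_of_both {n k : ℕ} (p q : ℕ) (hp : p ≤ k) (hq : q ≤ k) : memZk n k (-p) (-q) := by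
  refine ⟨1, 2 * k - p - q, (q : ℤ) - p, by omega, by omega, ?_, Or.inl ?_⟩
  · rw [Nat.cast_sub (by omega), Nat.cast_sub (by omega)]
    simp
    ring
  · simp
    ring

lemma memZk_of_rho {n k : ℕ} (p l : ℕ) (hp : p ≤ k) (hl : k - p ≤ l) :
    memZk n k (-p) (-(rhoC n) - l) := by
  have e : (Equiv.swap (1 : Fin 3) 2) 0 = 0 := by decide
  by_cases h : k ≤ l
  · refine ⟨Equiv.swap 1 2, l, (l : ℤ) - 2 * k, by omega, by omega, by simp, Or.inr ?_⟩
    simp [e]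
    ring
  · refine ⟨Equiv.swap 1 2, l, 2 * (k : ℤ) - 2 * p - l, by omega, by omega, by simp, Or.inl ?_⟩
    simp [e]
    ring

lemma uniqueSolS_of_right {n k : ℕ} {lam₁ lam₂ : ℂ} (h : ¬ memZk n k lam₁ lam₂)
    (hB : ∀ t : ℕ, 1 ≤ t → t ≤ k → (t : ℂ) + lam₂ ≠ 0) : UniqueSolS n k lam₁ lam₂ := by
  by_cases hA : ∀ r : ℕ, 1 ≤ r → r ≤ k → (r : ℂ) + lam₁ ≠ 0
  · exact uniqueSolS_of_start 0 (Nat.zero_le k) (by simp) hA hB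
      fun c hc r t hr => hc.1 r t (Or.inl (by simpa using hr))
  · push Not at hA
    obtain ⟨p, -, hpk, hp⟩ := hA
    obtain rfl : lam₁ = -p := by linear_combination hp
    refine uniqueSolS_of_start p hpk (by simp) (fun r hr _ e => ?_) hB
      fun c hc => hc.eq_zero_of_lt p hpk hp hB ?_
    · rw [← sub_eq_add_neg, sub_eq_zero, Nat.cast_inj] at e
      omega
    · rintro l hl rfl
      exact h (memZk_of_rho p l hpk hl)

/-- for `(λ₁,λ₂) ∉ Z_k`, the space of solutions of the system (S) is
one-dimensional. -/
theorem solS_one_dimensional (n : ℕ) (hn : 4 ≤ n) (k : ℕ) (lam₁ lam₂ : ℂ)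
    (h : ¬ memZk n k lam₁ lam₂) :
    ∃ c₀ : ℤ → ℤ → ℂ, IsSolS n k lam₁ lam₂ c₀ ∧ c₀ ≠ 0 ∧
      ∀ c : ℤ → ℤ → ℂ, IsSolS n k lam₁ lam₂ c →
        ∃ a : ℂ, ∀ r t : ℤ, c r t = a * c₀ r t := by
  by_cases hB : ∀ t : ℕ, 1 ≤ t → t ≤ k → (t : ℂ) + lam₂ ≠ 0
  · exact uniqueSolS_of_right h hB
  · refine (uniqueSolS_of_right (fun h' => h (memZk_swap h')) fun p _ hpk hp => h ?_).swap
    push Not at hB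
    obtain ⟨q, -, hqk, hq⟩ := hB
    obtain rfl : lam₁ = -p := by linear_combination hp
    obtain rfl : lam₂ = -q := by linear_combination hq
    exact memZk_of_both p q hpk hqk
end

section
/- Let n ≥ 4, ρ = (n−1)/2, k ∈ ℕ, and let p, q be integers with 1 ≤ p, q ≤ k and p + q < k. Set λ₁ = −p and λ₂ = −q. Then the space of solutions of the system (S) is at most one-dimensional: any two solutions are proportional, and every solution c with c_{p,q} = 0 vanishes identically. -/
/-- Interchanging the two indices interchanges the two families of equations. -/
theorem IsSolS.swap_s14 {n k : ℕ} {lam₁ lam₂ : ℂ} {c : ℤ → ℤ → ℂ} (h : IsSolS n k lam₁ lam₂ c) :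
    IsSolS n k lam₂ lam₁ (fun r t => c t r) := by
  obtain ⟨h0, h1, h2⟩ := h
  refine ⟨fun r t hrt => h0 t r (by omega), fun r t hr ht hrt => ?_, fun r t hr ht hrt => ?_⟩
  · linear_combination h2 t r ht hr (by omega)
  · linear_combination h1 t r ht hr (by omega)

theorem IsSolS.sub_smul {n k : ℕ} {lam₁ lam₂ : ℂ} {c c' : ℤ → ℤ → ℂ}
    (h : IsSolS n k lam₁ lam₂ c) (h' : IsSolS n k lam₁ lam₂ c') (a : ℂ) :
    IsSolS n k lam₁ lam₂ (fun r t => c' r t - a * c r t) := by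
  obtain ⟨h0, h1, h2⟩ := h
  obtain ⟨h0', h1', h2'⟩ := h'
  refine ⟨fun r t hrt => ?_, fun r t hr ht hrt => ?_, fun r t hr ht hrt => ?_⟩
  · simp [h0 r t hrt, h0' r t hrt]
  · linear_combination h1' r t hr ht hrt - a * h1 r t hr ht hrt
  · linear_combination h2' r t hr ht hrt - a * h2 r t hr ht hrt

/-- The middle coefficient of the first equation does not vanish to the left of `r = p`. -/
theorem middle_coeff_ne_zero {n k p q : ℕ} (hn : 4 ≤ n) (hpq : p + q < k) {r t : ℤ}
    (hr : r < p) (ht : 0 ≤ t) :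
    (k : ℂ) - r + t - 1 + rhoC n + -(q : ℂ) ≠ 0 := by
  intro h
  have h' : ((2 * ((k : ℤ) - r + t - 1 - q) + n - 1 : ℤ) : ℂ) = 0 := by
    unfold rhoC at h
    push_cast
    linear_combination 2 * h
  rw [Int.cast_eq_zero] at h'
  omega

/-- One step to the left in a row, given that the previous row vanishes. -/
theorem IsSolS.eq_zero_of_right {n k p q : ℕ} {c : ℤ → ℤ → ℂ} (hn : 4 ≤ n) (hpq : p + q < k)
    (h : IsSolS n k (-(p : ℂ)) (-(q : ℂ)) c) {r t : ℤ} (hr : r < p)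
    (hprev : ∀ r' : ℤ, r' < p → c r' (t - 1) = 0)
    (hnext : r + 1 = p ∨ c (r + 1) t = 0) : c r t = 0 := by
  obtain ⟨h0, h1, h2⟩ := h
  by_cases hout : r < 0 ∨ t < 0 ∨ (k : ℤ) < r + t
  · exact h0 r t hout
  have hr0 : 0 ≤ r := by omega
  have ht0 : 0 ≤ t := by omega
  rcases eq_or_ne (r + t) (k : ℤ) with hk | hk
  · have e := h2 r (t - 1) hr0 (by omega) (by omega)
    rw [hprev r hr, hprev (r - 1) (by omega), sub_add_cancel] at e
    have ha : (t : ℂ) ≠ 0 := by exact_mod_cast (by omega : t ≠ 0)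
    have hb : (t : ℂ) - q ≠ 0 := by exact_mod_cast (by omega : t - q ≠ 0)
    refine (mul_eq_zero.mp (?_ : ((t : ℂ) * (t - q)) * c r t = 0)).resolve_left
      (mul_ne_zero ha hb)
    push_cast at e
    linear_combination e / 4
  · have e := h1 r t hr0 ht0 (by omega)
    have hz : ((r : ℂ) + 1 + -(p : ℂ)) * c (r + 1) t = 0 := by
      rcases hnext with hp | hp
      · have : (r : ℂ) + 1 = p := by exact_mod_cast hp
        rw [this]
        ring
      · rw [hp, mul_zero]
    have ha : (k : ℂ) - r - t ≠ 0 := by exact_mod_cast (by omega : (k : ℤ) - r - t ≠ 0)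
    rw [hprev r hr] at e
    refine (mul_eq_zero.mp (?_ : (((k : ℂ) - r - t) *
      ((k : ℂ) - r + t - 1 + rhoC n + -(q : ℂ))) * c r t = 0)).resolve_left
      (mul_ne_zero ha (middle_coeff_ne_zero hn hpq hr ht0))
    linear_combination e / 2 - 2 * ((r : ℂ) + 1) * hz

theorem IsSolS.eq_zero_of_lt_s14 {n k p q : ℕ} {c : ℤ → ℤ → ℂ} (hn : 4 ≤ n) (hpq : p + q < k)
    (h : IsSolS n k (-(p : ℂ)) (-(q : ℂ)) c) {r : ℤ} (hr : r < p) (t : ℤ) : c r t = 0 := by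
  rcases lt_or_ge t (-1) with ht | ht
  · exact h.1 r t (by omega)
  induction t, ht using Int.leInduction generalizing r with
  | base => exact h.1 r (-1) (by omega)
  | succ t ht ih =>
    have hprev : ∀ r' : ℤ, r' < p → c r' (t + 1 - 1) = 0 := by simpa using fun r' => @ih r'
    have hle : r ≤ (p : ℤ) - 1 := by omega
    clear hr
    induction r, hle using Int.leInductionDown with
    | base => exact h.eq_zero_of_right hn hpq (by omega) hprev (Or.inl (by omega))
    | pred r hr ihr =>
      exact h.eq_zero_of_right hn hpq (by omega) hprev (Or.inr (by simpa using ihr))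

/-- A solution is determined by its value at `(p, q)`. -/
theorem IsSolS.eq_zero {n k p q : ℕ} {c : ℤ → ℤ → ℂ} (hn : 4 ≤ n) (hpq : p + q < k)
    (h : IsSolS n k (-(p : ℂ)) (-(q : ℂ)) c) (hc : c p q = 0) : c = 0 := by
  have hleft : ∀ r t : ℤ, r < p → c r t = 0 := fun r t hr => h.eq_zero_of_lt_s14 hn hpq hr t
  have hbelow : ∀ r t : ℤ, t < q → c r t = 0 := fun r t ht =>
    h.swap_s14.eq_zero_of_lt_s14 hn (by omega) ht r
  obtain ⟨h0, h1, h2⟩ := h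
  have hrow : ∀ r : ℤ, c r q = 0 := by
    intro r
    rcases lt_or_ge r p with hr | hr
    · exact hleft r q hr
    induction r, hr using Int.leInduction with
    | base => exact hc
    | succ r hr ih =>
      by_cases hk : (k : ℤ) < r + 1 + q
      · exact h0 _ _ (by omega)
      have e := h1 r q (by omega) (by omega) (by omega)
      rw [ih, hbelow r (q - 1) (by omega)] at e
      have ha : (r : ℂ) + 1 ≠ 0 := by exact_mod_cast (by omega : r + 1 ≠ 0)
      have hb : (r : ℂ) + 1 - p ≠ 0 := by exact_mod_cast (by omega : r + 1 - p ≠ 0)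
      refine (mul_eq_zero.mp (?_ : (((r : ℂ) + 1) * (r + 1 - p)) * c (r + 1) q = 0)).resolve_left
        (mul_ne_zero ha hb)
      linear_combination e / 4
  funext r t
  change c r t = 0
  rcases lt_or_ge t q with ht | ht
  · exact hbelow r t ht
  induction t, ht using Int.leInduction generalizing r with
  | base => exact hrow r
  | succ t ht ih =>
    by_cases hk : r < 0 ∨ (k : ℤ) < r + (t + 1)
    · exact h0 _ _ (by omega)
    have e := h2 r t (by omega) (by omega) (by omega)
    rw [ih r, ih (r - 1)] at e
    have ha : (t : ℂ) + 1 ≠ 0 := by exact_mod_cast (by omega : t + 1 ≠ 0)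
    have hb : (t : ℂ) + 1 - q ≠ 0 := by exact_mod_cast (by omega : t + 1 - q ≠ 0)
    refine (mul_eq_zero.mp (?_ : (((t : ℂ) + 1) * (t + 1 - q)) * c r (t + 1) = 0)).resolve_left
      (mul_ne_zero ha hb)
    linear_combination e / 4

/-- for `λ₁ = -p`, `λ₂ = -q` with `1 ≤ p,q ≤ k` and `p + q < k`, the space of
solutions of the system (S) is at most one-dimensional: every solution with `c_{p,q} = 0`
vanishes identically, and any two solutions are proportional. -/
theorem solS_at_most_one_dimensional_neg_int (n : ℕ) (hn : 4 ≤ n) (k p q : ℕ)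
    (hp : 1 ≤ p) (hq : 1 ≤ q) (hpk : p ≤ k) (hqk : q ≤ k) (hpq : p + q < k) :
    (∀ c : ℤ → ℤ → ℂ, IsSolS n k (-(p : ℂ)) (-(q : ℂ)) c → c p q = 0 → c = 0) ∧
    (∀ c c' : ℤ → ℤ → ℂ, IsSolS n k (-(p : ℂ)) (-(q : ℂ)) c →
      IsSolS n k (-(p : ℂ)) (-(q : ℂ)) c' →
      ∃ a : ℂ, (∀ r t : ℤ, c' r t = a * c r t) ∨ (∀ r t : ℤ, c r t = a * c' r t)) := by
  refine ⟨fun c h hc => h.eq_zero hn hpq hc, fun c c' h h' => ?_⟩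
  by_cases hc : c p q = 0
  · exact ⟨0, Or.inr fun r t => by simp [h.eq_zero hn hpq hc]⟩
  · refine ⟨c' p q / c p q, Or.inl fun r t => ?_⟩
    have hz := (h.sub_smul h' (c' p q / c p q)).eq_zero hn hpq (by field_simp; simp)
    exact sub_eq_zero.mp (congrFun (congrFun hz r) t)
end
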